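/- arXiv:0908.1060 — 2 statements merged into one kernel-verified Lean document; each statement's English description precedes it below -/
import Mathlib

section
/- (Complete one-dimensional spectrum.) Assume F satisfies (F1), (F2) and (F3). Then the eigenvalue problem F(u''(t), u'(t), u(t), t) = −μ·u(t) in (a,b), u(a) = u(b) = 0, admits two sequences of solution pairs {(λₙ⁺, uₙ⁺)}_{n≥0} and {(λₙ⁻, uₙ⁻)}_{n≥0} with uₙ± ∈ C²(a,b) ∩ C¹([a,b]) not identically zero, such that: uₙ⁺ and uₙ⁻ each have exactly n zeros t₁ < ... < tₙ in the open interval (a,b); uₙ⁺ (resp. uₙ⁻) is positive (resp. negative) on (a,t₁) and changes sign at each interior zero (so it is negative (resp. positive) on (t₁,t₂), and so on alternately); the sequences (λₙ⁺) and (λₙ⁻) are strictly increasing in n; and the family is complete: every pair (μ, u) with u ∈ C²(a,b) ∩ C¹([a,b]) not identically zero solving the eigenvalue problem satisfies, for some n, either μ = λₙ⁺ and u is a scalar multiple of uₙ⁺, or μ = λₙ⁻ and u is a scalar multiple of uₙ⁻. -/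
open Set

/-- `u ∈ C²(a,b) ∩ C¹([a,b])`, with first derivative `u'` (one-sided at the endpoints)
and second derivative `u''` on the open interval. -/
def C2Fun (a b : ℝ) (u u' u'' : ℝ → ℝ) : Prop :=
  (∀ t ∈ Set.Icc a b, HasDerivWithinAt u (u' t) (Set.Icc a b) t) ∧
  ContinuousOn u' (Set.Icc a b) ∧
  (∀ t ∈ Set.Ioo a b, HasDerivAt u' (u'' t) t) ∧
  ContinuousOn u'' (Set.Ioo a b)

/-- `(μ,u)` solves the Dirichlet eigenvalue problem on `(a,b)`. -/
def IsEigenpair (F : ℝ → ℝ → ℝ → ℝ → ℝ) (a b μ : ℝ) (u u' u'' : ℝ → ℝ) : Prop :=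
  C2Fun a b u u' u'' ∧
  (∀ t ∈ Set.Ioo a b, F (u'' t) (u' t) (u t) t = -μ * u t) ∧
  u a = 0 ∧ u b = 0

/-- `u` has exactly `n` interior zeros `z 1 < ... < z n` in `(a,b)` (with `z 0 = a`,
`z (n+1) = b`) and on the nodal interval `(z i, z (i+1))` its sign is `sgn·(-1)^i`. -/
def HasNodalStructure (a b : ℝ) (n : ℕ) (sgn : ℝ) (u : ℝ → ℝ) : Prop :=
  ∃ z : ℕ → ℝ, z 0 = a ∧ z (n + 1) = b ∧
    (∀ i : ℕ, i ≤ n → z i < z (i + 1)) ∧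
    (∀ t ∈ Set.Ioo a b, (u t = 0 ↔ ∃ i : ℕ, 1 ≤ i ∧ i ≤ n ∧ t = z i)) ∧
    (∀ i : ℕ, i ≤ n → ∀ t ∈ Set.Ioo (z i) (z (i + 1)), 0 < sgn * (-1 : ℝ) ^ i * u t)

/-- Structural properties of the function `Φ` for which `F(m,p,u,t) = r` is equivalent to
`m = Φ(p,u,r,t)`. -/
structure IsNormalForm (Φ : ℝ → ℝ → ℝ → ℝ → ℝ) (A κ : ℝ) : Prop where
  A_nonneg : 0 ≤ A
  κ_pos : 0 < κ
  cont : ∀ p u r, Continuous (Φ p u r)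
  lip : ∀ p u r p' u' r' t,
    |Φ p u r t - Φ p' u' r' t| ≤ A * (|p - p'| + |u - u'| + |r - r'|)
  mono : ∀ p u t r r', r ≤ r' → κ * (r' - r) ≤ Φ p u r' t - Φ p u r t
  hom : ∀ s, 0 ≤ s → ∀ p u r t, Φ (s * p) (s * u) (s * r) t = s * Φ p u r t

theorem exists_isNormalForm
    {a b lam Lam gam del : ℝ} (hab : a < b)
    (hlam : 0 < lam) (hLam : lam ≤ Lam) (hgam : 0 < gam) (hdel : 0 < del)
    {F : ℝ → ℝ → ℝ → ℝ → ℝ}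
    (hFcont : ContinuousOn (fun z : ℝ × ℝ × ℝ × ℝ => F z.1 z.2.1 z.2.2.1 z.2.2.2)
      {z : ℝ × ℝ × ℝ × ℝ | z.2.2.2 ∈ Icc a b})
    (hF1 : ∀ s : ℝ, 0 ≤ s → ∀ m p u : ℝ, ∀ t ∈ Icc a b,
      F (s * m) (s * p) (s * u) t = s * F m p u t)
    (hF2 : ∀ m p u m' p' u' : ℝ, ∀ t ∈ Icc a b,
      lam * max (m - m') 0 - Lam * max (-(m - m')) 0 - gam * |p - p'| - del * |u - u'|
          ≤ F m p u t - F m' p' u' t ∧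
        F m p u t - F m' p' u' t
          ≤ Lam * max (m - m') 0 - lam * max (-(m - m')) 0 + gam * |p - p'| + del * |u - u'|) :
    ∃ Φ : ℝ → ℝ → ℝ → ℝ → ℝ, ∃ A κ : ℝ, IsNormalForm Φ A κ ∧
      ∀ t ∈ Icc a b, ∀ m p u r, F m p u t = r ↔ m = Φ p u r t := by
  have hsub : ∀ m p u m' p' u' : ℝ, ∀ t ∈ Icc a b,
      lam * |m - m'| ≤ gam * |p - p'| + del * |u - u'| + |F m p u t - F m' p' u' t| := by
    intro m p u m' p' u' t ht
    obtain ⟨h1, h2⟩ := hF2 m p u m' p' u' t ht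
    rcases le_total m' m with h | h
    · rw [max_eq_left (by linarith), max_eq_right (by linarith)] at h1
      rw [abs_of_nonneg (sub_nonneg.2 h)]
      linarith [le_abs_self (F m p u t - F m' p' u' t)]
    · rw [max_eq_right (by linarith), max_eq_left (by linarith)] at h2
      rw [abs_of_nonpos (sub_nonpos.2 h)]
      linarith [neg_abs_le (F m p u t - F m' p' u' t)]
  have hmono : ∀ p u : ℝ, ∀ t ∈ Icc a b, ∀ m m', m ≤ m' →
      lam * (m' - m) ≤ F m' p u t - F m p u t ∧ F m' p u t - F m p u t ≤ Lam * (m' - m) := by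
    intro p u t ht m m' h
    have := hF2 m' p u m p u t ht
    rw [max_eq_left (by linarith), max_eq_right (by linarith)] at this
    simpa using this
  have hsurj : ∀ p u r : ℝ, ∀ t ∈ Icc a b, ∃ m, F m p u t = r := by
    intro p u r t ht
    set M := |r - F 0 p u t| / lam
    have hM : 0 ≤ M := by positivity
    have hlM : lam * M = |r - F 0 p u t| := by simp only [M]; field_simp
    have hc : ContinuousOn (fun m => F m p u t) (Icc (-M) M) :=
      hFcont.comp (f := fun m : ℝ => (m, p, u, t)) (by fun_prop) (fun m _ => ht)
    obtain ⟨m, -, hm⟩ := intermediate_value_Icc (by linarith : -M ≤ M) hc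
      (show r ∈ Icc _ _ by
        have h1 := (hmono p u t ht 0 M hM).1
        have h2 := (hmono p u t ht (-M) 0 (by linarith)).1
        constructor
        · linarith [neg_abs_le (r - F 0 p u t)]
        · linarith [le_abs_self (r - F 0 p u t)])
    exact ⟨m, hm⟩
  set τ : ℝ → ℝ := fun t => (projIcc a b hab.le t : ℝ)
  have hτ : ∀ t, τ t ∈ Icc a b := fun t => (projIcc a b hab.le t).2
  have hτc : Continuous τ := continuous_subtype_val.comp continuous_projIcc
  have hex : ∀ p u r t, ∃ m, F m p u (τ t) = r := fun p u r t => hsurj p u r _ (hτ t)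
  choose Φ hΦ using hex
  refine ⟨Φ, (gam + del + 1) / lam, 1 / Lam, ⟨by positivity, ?_, ?_, ?_, ?_, ?_⟩, ?_⟩
  · have : 0 < Lam := by linarith
    positivity
  · intro p u r
    rw [continuous_iff_continuousAt]
    intro t
    have h0 : Continuous fun s => F (Φ p u r t) p u (τ s) := by
      rw [← continuousOn_univ]
      exact hFcont.comp (f := fun s : ℝ => (Φ p u r t, p, u, τ s)) (by fun_prop)
        (fun s _ => hτ s)
    have h1 : Continuous fun s => |r - F (Φ p u r t) p u (τ s)| / lam :=
      (continuous_const.sub h0).abs.div_const lam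
    have h2 := h1.tendsto t
    simp only [hΦ, sub_self, abs_zero, zero_div] at h2
    refine tendsto_iff_dist_tendsto_zero.2
      (squeeze_zero (fun _ => dist_nonneg) (fun s => ?_) h2)
    have := hsub (Φ p u r s) p u (Φ p u r t) p u _ (hτ s)
    simp only [sub_self, abs_zero, mul_zero, add_zero, zero_add, hΦ] at this
    rw [Real.dist_eq, le_div_iff₀ hlam]
    linarith
  · intro p u r p' u' r' t
    have := hsub (Φ p u r t) p u (Φ p' u' r' t) p' u' _ (hτ t)
    simp only [hΦ] at this
    rw [div_mul_eq_mul_div, le_div_iff₀ hlam]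
    nlinarith [abs_nonneg (p - p'), abs_nonneg (u - u'), abs_nonneg (r - r')]
  · intro p u t r r' h
    have hL : 0 < Lam := by linarith
    have hle : Φ p u r t ≤ Φ p u r' t := by
      by_contra hlt
      push Not at hlt
      have := (hmono p u _ (hτ t) _ _ hlt.le).1
      rw [hΦ, hΦ] at this
      nlinarith
    have := (hmono p u _ (hτ t) _ _ hle).2
    rw [hΦ, hΦ] at this
    rw [one_div_mul_eq_div, div_le_iff₀ hL]
    linarith
  · intro s hs p u r t
    have h1 := hF1 s hs (Φ p u r t) p u _ (hτ t)
    rw [hΦ] at h1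
    have := hsub (Φ (s * p) (s * u) (s * r) t) (s * p) (s * u) (s * Φ p u r t) (s * p) (s * u)
      _ (hτ t)
    rw [hΦ, h1] at this
    simp only [sub_self, abs_zero, mul_zero, add_zero] at this
    have h0 : |Φ (s * p) (s * u) (s * r) t - s * Φ p u r t| ≤ 0 := by
      by_contra h
      push Not at h
      nlinarith
    linarith [abs_nonpos_iff.1 h0]
  · intro t ht m p u r
    have hτt : τ t = t := by simp only [τ, projIcc_of_mem hab.le ht]
    have hr := hΦ p u r t
    rw [hτt] at hr
    constructor
    · intro h
      have := hsub m p u (Φ p u r t) p u t ht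
      rw [h, hr] at this
      simp only [sub_self, abs_zero, mul_zero, add_zero] at this
      have h0 : |m - Φ p u r t| ≤ 0 := by
        by_contra h
        push Not at h
        nlinarith
      linarith [abs_nonpos_iff.1 h0]
    · rintro rfl
      exact hr

namespace IsNormalForm

variable {Φ : ℝ → ℝ → ℝ → ℝ → ℝ} {A κ : ℝ}

theorem abs_le (h : IsNormalForm Φ A κ) (p u r t : ℝ) :
    |Φ p u r t| ≤ A * (|p| + |u| + |r|) := by
  have h0 := h.hom 0 le_rfl 0 0 0 t
  have := h.lip p u r 0 0 0 t
  simp only [mul_zero, zero_mul] at h0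
  simpa [h0] using this

theorem continuous_uncurry (h : IsNormalForm Φ A κ) :
    Continuous fun z : ℝ × ℝ × ℝ × ℝ => Φ z.1 z.2.1 z.2.2.1 z.2.2.2 := by
  rw [continuous_iff_continuousAt]
  rintro ⟨p, u, r, t⟩
  have h1 : Continuous fun z : ℝ × ℝ × ℝ × ℝ =>
      A * (|z.1 - p| + |z.2.1 - u| + |z.2.2.1 - r|) + |Φ p u r z.2.2.2 - Φ p u r t| := by
    have := h.cont p u r
    fun_prop
  have h2 := h1.tendsto (p, u, r, t)
  simp only [sub_self, abs_zero, add_zero, mul_zero] at h2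
  refine tendsto_iff_dist_tendsto_zero.2
    (squeeze_zero (fun _ => dist_nonneg) (fun z => ?_) h2)
  rw [Real.dist_eq]
  exact (abs_sub_le _ (Φ p u r z.2.2.2) _).trans (add_le_add_left (h.lip _ _ _ _ _ _ _) _)

end IsNormalForm

/-- The right-hand side of the equation `θ' = prufer Φ μ t θ` of the angle of a solution
`u = ρ sin θ`, `u' = ρ cos θ` of `u'' = Φ u' u (-μ u) t`. -/
noncomputable def prufer (Φ : ℝ → ℝ → ℝ → ℝ → ℝ) (μ t θ : ℝ) : ℝ :=
  Real.cos θ ^ 2 - Real.sin θ * Φ (Real.cos θ) (Real.sin θ) (-μ * Real.sin θ) t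

section Prufer

variable {Φ : ℝ → ℝ → ℝ → ℝ → ℝ} {A κ : ℝ}

theorem IsNormalForm.abs_circle_le (h : IsNormalForm Φ A κ) (μ t θ : ℝ) :
    |Φ (Real.cos θ) (Real.sin θ) (-μ * Real.sin θ) t| ≤ A * (2 + |μ|) := by
  refine (h.abs_le _ _ _ _).trans (mul_le_mul_of_nonneg_left ?_ h.A_nonneg)
  rw [abs_mul, abs_neg]
  nlinarith [Real.abs_cos_le_one θ, Real.abs_sin_le_one θ, abs_nonneg μ]

theorem abs_prufer_le (h : IsNormalForm Φ A κ) (μ t θ : ℝ) :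
    |prufer Φ μ t θ| ≤ 1 + A * (2 + |μ|) := by
  have h1 := h.abs_circle_le μ t θ
  refine (abs_sub _ _).trans (add_le_add ?_ ?_)
  · rw [abs_of_nonneg (sq_nonneg _)]
    exact Real.cos_sq_le_one θ
  · rw [abs_mul]
    nlinarith [Real.abs_sin_le_one θ, abs_nonneg (Real.sin θ),
      abs_nonneg (Φ (Real.cos θ) (Real.sin θ) (-μ * Real.sin θ) t)]

theorem abs_prufer_sub_prufer_le (h : IsNormalForm Φ A κ) (μ t x y : ℝ) :
    |prufer Φ μ t x - prufer Φ μ t y| ≤ (2 + 2 * (A * (2 + |μ|))) * |x - y| := by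
  have hs := Real.abs_sin_sub_sin_le x y
  have hc := Real.abs_cos_sub_cos_le x y
  have hA := h.A_nonneg
  have h1 : |Φ (Real.cos x) (Real.sin x) (-μ * Real.sin x) t
      - Φ (Real.cos y) (Real.sin y) (-μ * Real.sin y) t| ≤ A * (2 + |μ|) * |x - y| := by
    refine (h.lip _ _ _ _ _ _ _).trans ?_
    rw [mul_assoc, ← mul_sub, abs_mul, abs_neg]
    refine mul_le_mul_of_nonneg_left ?_ hA
    nlinarith [mul_le_mul_of_nonneg_left hs (abs_nonneg μ)]
  have h2 : |Real.cos x ^ 2 - Real.cos y ^ 2| ≤ 2 * |x - y| := by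
    rw [sq_sub_sq, abs_mul]
    refine mul_le_mul ((abs_add_le _ _).trans ?_) hc (abs_nonneg _) (by norm_num)
    linarith [Real.abs_cos_le_one x, Real.abs_cos_le_one y]
  have h3 := h.abs_circle_le μ t y
  have key : prufer Φ μ t x - prufer Φ μ t y = (Real.cos x ^ 2 - Real.cos y ^ 2)
      - Real.sin x * (Φ (Real.cos x) (Real.sin x) (-μ * Real.sin x) t
        - Φ (Real.cos y) (Real.sin y) (-μ * Real.sin y) t)
      - (Real.sin x - Real.sin y) * Φ (Real.cos y) (Real.sin y) (-μ * Real.sin y) t := by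
    unfold prufer
    ring
  rw [key]
  refine (abs_sub _ _).trans ((add_le_add_left (abs_sub _ _) _).trans ?_)
  rw [abs_mul, abs_mul]
  have h4 := mul_le_mul (Real.abs_sin_le_one x) h1 (abs_nonneg _) zero_le_one
  have h5 := mul_le_mul hs h3 (abs_nonneg _) (abs_nonneg _)
  linarith

theorem abs_prufer_sub_le (h : IsNormalForm Φ A κ) (μ μ' t θ : ℝ) :
    |prufer Φ μ t θ - prufer Φ μ' t θ| ≤ A * |μ - μ'| := by
  have h1 := h.lip (Real.cos θ) (Real.sin θ) (-μ * Real.sin θ) (Real.cos θ) (Real.sin θ)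
    (-μ' * Real.sin θ) t
  have hs := Real.abs_sin_le_one θ
  have hA := h.A_nonneg
  rw [← sub_mul, abs_mul, sub_self, sub_self, abs_zero, zero_add, zero_add] at h1
  have key : prufer Φ μ t θ - prufer Φ μ' t θ = - (Real.sin θ *
      (Φ (Real.cos θ) (Real.sin θ) (-μ * Real.sin θ) t
        - Φ (Real.cos θ) (Real.sin θ) (-μ' * Real.sin θ) t)) := by
    unfold prufer
    ring
  rw [key, abs_neg, abs_mul]
  have h2 : |-μ - -μ'| = |μ - μ'| := by rw [← abs_neg]; ring_nf
  rw [h2] at h1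
  have h3 : A * (|μ - μ'| * |Real.sin θ|) ≤ A * |μ - μ'| :=
    mul_le_mul_of_nonneg_left (mul_le_of_le_one_right (abs_nonneg _) hs) hA
  exact (mul_le_of_le_one_left (abs_nonneg _) hs).trans (h1.trans h3)

theorem le_prufer_sub (h : IsNormalForm Φ A κ) {μ μ' : ℝ} (hμ : μ ≤ μ') (t θ : ℝ) :
    κ * (μ' - μ) * Real.sin θ ^ 2 ≤ prufer Φ μ' t θ - prufer Φ μ t θ := by
  unfold prufer
  rcases le_total 0 (Real.sin θ) with hs | hs
  · have := h.mono (Real.cos θ) (Real.sin θ) t (-μ' * Real.sin θ) (-μ * Real.sin θ) (by nlinarith)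
    nlinarith [mul_le_mul_of_nonneg_left this hs]
  · have := h.mono (Real.cos θ) (Real.sin θ) t (-μ * Real.sin θ) (-μ' * Real.sin θ) (by nlinarith)
    nlinarith [mul_le_mul_of_nonpos_left this hs]

theorem prufer_int_mul_pi (μ t : ℝ) (k : ℤ) : prufer Φ μ t (k * Real.pi) = 1 := by
  rw [prufer, Real.cos_sq', Real.sin_int_mul_pi]
  simp

theorem continuous_prufer (h : IsNormalForm Φ A κ) (μ θ : ℝ) :
    Continuous fun t => prufer Φ μ t θ :=
  continuous_const.sub (continuous_const.mul (h.cont _ _ _))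

/-- `θ` is the angle of a solution on `[a,b]`. -/
def IsAngle (Φ : ℝ → ℝ → ℝ → ℝ → ℝ) (a b μ : ℝ) (θ : ℝ → ℝ) : Prop :=
  ∀ t ∈ Icc a b, HasDerivWithinAt θ (prufer Φ μ t (θ t)) (Icc a b) t

theorem exists_isAngle (h : IsNormalForm Φ A κ) {a b : ℝ} (hab : a < b) (μ θ₀ : ℝ) :
    ∃ θ : ℝ → ℝ, θ a = θ₀ ∧ IsAngle Φ a b μ θ := by
  have hA := h.A_nonneg
  have hB : 0 ≤ A * (2 + |μ|) := by positivity
  set L : NNReal := ⟨1 + A * (2 + |μ|), by positivity⟩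
  set K : NNReal := ⟨2 + 2 * (A * (2 + |μ|)), by positivity⟩
  set d : NNReal := ⟨b - a, by linarith⟩
  have hP : IsPicardLindelof (prufer Φ μ) (⟨a, left_mem_Icc.2 hab.le⟩ : Icc a b) θ₀
      (L * d) 0 L K := by
    refine ⟨fun t _ => LipschitzWith.lipschitzOnWith (LipschitzWith.of_dist_le_mul
      fun x y => abs_prufer_sub_prufer_le h μ t x y), fun x _ =>
      (continuous_prufer h μ x).continuousOn, fun t _ x _ => abs_prufer_le h μ t x, ?_⟩
    have : max (b - a) (a - a) = (d : ℝ) := by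
      rw [sub_self, max_eq_left (by linarith)]
      rfl
    simp only [this, NNReal.coe_mul, NNReal.coe_zero, sub_zero, le_refl]
  obtain ⟨θ, h1, h2⟩ := hP.exists_eq_forall_mem_Icc_hasDerivWithinAt₀
  exact ⟨θ, h1, h2⟩

theorem mul_exp_le_mul_exp {w w' : ℝ → ℝ} {a b c : ℝ} (hab : a ≤ b)
    (hw : ContinuousOn w (Icc a b)) (hw' : ∀ t ∈ Ioo a b, HasDerivAt w (w' t) t)
    (hle : ∀ t ∈ Ioo a b, c * w t ≤ w' t) :
    w a * Real.exp (-c * a) ≤ w b * Real.exp (-c * b) := by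
  have hd : ∀ t ∈ Ioo a b, HasDerivAt (fun s => w s * Real.exp (-c * s))
      ((w' t - c * w t) * Real.exp (-c * t)) t := by
    intro t ht
    have h1 : HasDerivAt (fun s => Real.exp (-c * s)) (Real.exp (-c * t) * (-c * 1)) t :=
      ((hasDerivAt_id t).const_mul (-c)).exp
    convert! (hw' t ht).mul h1 using 1
    ring
  have hm : MonotoneOn (fun s => w s * Real.exp (-c * s)) (Icc a b) := by
    refine monotoneOn_of_deriv_nonneg (convex_Icc a b) (hw.mul (by fun_prop)) ?_ ?_ <;>
      rw [interior_Icc]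
    · exact fun t ht => (hd t ht).differentiableAt.differentiableWithinAt
    · intro t ht
      rw [(hd t ht).deriv]
      exact mul_nonneg (sub_nonneg.2 (hle t ht)) (Real.exp_pos _).le
  exact hm (left_mem_Icc.2 hab) (right_mem_Icc.2 hab) hab

theorem nonneg_of_neg_mul_abs_le_deriv {w w' : ℝ → ℝ} {a b K : ℝ}
    (hw : ContinuousOn w (Icc a b)) (hw' : ∀ t ∈ Ioo a b, HasDerivAt w (w' t) t)
    (hle : ∀ t ∈ Ioo a b, -(K * |w t|) ≤ w' t) (ha : 0 ≤ w a) :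
    ∀ t ∈ Icc a b, 0 ≤ w t := by
  intro t ht
  by_contra hlt
  push Not at hlt
  have hsub : Icc a t ⊆ Icc a b := Icc_subset_Icc_right ht.2
  have hcl : IsCompact (Icc a t ∩ w ⁻¹' Ici 0) :=
    isCompact_Icc.of_isClosed_subset
      ((hw.mono hsub).preimage_isClosed_of_isClosed isClosed_Icc isClosed_Ici) inter_subset_left
  obtain ⟨s, ⟨hs, hs0⟩, hmax⟩ := hcl.exists_isGreatest ⟨a, left_mem_Icc.2 ht.1, ha⟩
  have hneg : ∀ x ∈ Ioo s t, w x < 0 := by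
    intro x hx
    by_contra h
    push Not at h
    exact absurd (hmax ⟨⟨hs.1.trans hx.1.le, hx.2.le⟩, h⟩) (not_le.2 hx.1)
  have hsub' : Ioo s t ⊆ Ioo a b := Ioo_subset_Ioo hs.1 ht.2
  have := mul_exp_le_mul_exp hs.2 (hw.mono (Icc_subset_Icc hs.1 ht.2))
    (fun x hx => hw' x (hsub' hx)) (c := K) (fun x hx => by
      have := hle x (hsub' hx)
      rw [abs_of_neg (hneg x hx)] at this
      linarith)
  have h1 : 0 ≤ w s * Real.exp (-K * s) := mul_nonneg hs0 (Real.exp_pos _).le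
  have h2 : w t * Real.exp (-K * t) < 0 := mul_neg_of_neg_of_pos hlt (Real.exp_pos _)
  linarith

theorem eq_zero_of_neg_mul_abs_le_deriv {w w' : ℝ → ℝ} {a b K : ℝ}
    (hw : ContinuousOn w (Icc a b)) (hw' : ∀ t ∈ Ioo a b, HasDerivAt w (w' t) t)
    (hle : ∀ t ∈ Ioo a b, -(K * |w t|) ≤ w' t) (ha : 0 ≤ w a) {t : ℝ} (ht : t ∈ Icc a b)
    (h0 : w t = 0) : ∀ s ∈ Icc a t, w s = 0 := by
  intro s hs
  have hpos := nonneg_of_neg_mul_abs_le_deriv hw hw' hle ha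
  have hsub' : Ioo s t ⊆ Ioo a b := Ioo_subset_Ioo hs.1 ht.2
  have := mul_exp_le_mul_exp hs.2 (hw.mono (Icc_subset_Icc hs.1 ht.2))
    (fun x hx => hw' x (hsub' hx)) (c := -K) (fun x hx => by
      have := hle x (hsub' hx)
      rw [abs_of_nonneg (hpos x (Ioo_subset_Icc_self (hsub' hx)))] at this
      linarith)
  rw [h0, zero_mul] at this
  have h1 := hpos s ⟨hs.1, hs.2.trans ht.2⟩
  exact le_antisymm (nonpos_of_mul_nonpos_left this (Real.exp_pos _)) h1

theorem prufer_comparison (h : IsNormalForm Φ A κ) {a b μ : ℝ} {θ θ' φ φ' : ℝ → ℝ}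
    (hθ : ContinuousOn θ (Icc a b)) (hθ' : ∀ t ∈ Ioo a b, HasDerivAt θ (θ' t) t)
    (hφ : ContinuousOn φ (Icc a b)) (hφ' : ∀ t ∈ Ioo a b, HasDerivAt φ (φ' t) t)
    (hθle : ∀ t ∈ Ioo a b, θ' t ≤ prufer Φ μ t (θ t))
    (hφle : ∀ t ∈ Ioo a b, prufer Φ μ t (φ t) ≤ φ' t) (ha : θ a ≤ φ a) :
    (∀ t ∈ Icc a b, θ t ≤ φ t) ∧
      ∀ t ∈ Icc a b, θ t = φ t → ∀ s ∈ Icc a t, θ s = φ s := by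
  have hw := hφ.sub hθ
  have hw' : ∀ t ∈ Ioo a b, HasDerivAt (φ - θ) (φ' t - θ' t) t :=
    fun t ht => (hφ' t ht).sub (hθ' t ht)
  have hle : ∀ t ∈ Ioo a b,
      -((2 + 2 * (A * (2 + |μ|))) * |(φ - θ) t|) ≤ φ' t - θ' t := by
    intro t ht
    have h1 := neg_abs_le (prufer Φ μ t (φ t) - prufer Φ μ t (θ t))
    have h2 := abs_prufer_sub_prufer_le h μ t (φ t) (θ t)
    have := hθle t ht
    have := hφle t ht
    rw [Pi.sub_apply]
    linarith
  have ha' : 0 ≤ (φ - θ) a := sub_nonneg.2 ha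
  exact ⟨fun t ht => sub_nonneg.1 (nonneg_of_neg_mul_abs_le_deriv hw hw' hle ha' t ht),
    fun t ht h0 s hs => (sub_eq_zero.1 (eq_zero_of_neg_mul_abs_le_deriv hw hw' hle ha' ht
      (sub_eq_zero.2 h0.symm) s hs)).symm⟩

namespace IsAngle

variable {a b μ : ℝ} {θ : ℝ → ℝ}

theorem continuousOn (hθ : IsAngle Φ a b μ θ) : ContinuousOn θ (Icc a b) :=
  fun t ht => (hθ t ht).continuousWithinAt

theorem hasDerivAt (hθ : IsAngle Φ a b μ θ) {t : ℝ} (ht : t ∈ Ioo a b) :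
    HasDerivAt θ (prufer Φ μ t (θ t)) t :=
  (hθ t (Ioo_subset_Icc_self ht)).hasDerivAt (Icc_mem_nhds ht.1 ht.2)

theorem int_mul_pi_lt (h : IsNormalForm Φ A κ) (hθ : IsAngle Φ a b μ θ) {s t : ℝ}
    (hs : a ≤ s) (hst : s < t) (ht : t ≤ b) {k : ℤ} (hk : k * Real.pi ≤ θ s) :
    k * Real.pi < θ t := by
  have hsub : Ioo s t ⊆ Ioo a b := Ioo_subset_Ioo hs ht
  obtain ⟨h1, h2⟩ := prufer_comparison h (a := s) (b := t) (μ := μ) (θ := fun _ => k * Real.pi)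
    (θ' := fun _ => 0) (φ := θ) (φ' := fun t => prufer Φ μ t (θ t)) continuousOn_const
    (fun x _ => hasDerivAt_const x _) (hθ.continuousOn.mono (Icc_subset_Icc hs ht))
    (fun x hx => hθ.hasDerivAt (hsub hx)) (fun x _ => by simp [prufer_int_mul_pi])
    (fun x _ => le_rfl) hk
  refine lt_of_le_of_ne (h1 t (right_mem_Icc.2 hst.le)) fun heq => ?_
  have h3 := h2 t (right_mem_Icc.2 hst.le) heq
  obtain ⟨x, hx⟩ := nonempty_Ioo.2 hst
  have h4 : HasDerivAt θ 0 x := by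
    refine (hasDerivAt_const x ((k : ℝ) * Real.pi)).congr_of_eventuallyEq ?_
    filter_upwards [Icc_mem_nhds hx.1 hx.2] with y hy using (h3 y hy).symm
  have h5 := (hθ.hasDerivAt (hsub hx)).unique h4
  rw [← h3 x (Ioo_subset_Icc_self hx), prufer_int_mul_pi] at h5
  exact one_ne_zero h5

theorem lt_of_lt (h : IsNormalForm Φ A κ) (hab : a < b) {μ' : ℝ} {φ : ℝ → ℝ}
    (hθ : IsAngle Φ a b μ θ) (hφ : IsAngle Φ a b μ' φ) (hμ : μ < μ') (ha : θ a ≤ φ a) :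
    θ b < φ b := by
  have hpos : 0 < κ * (μ' - μ) := mul_pos h.κ_pos (sub_pos.2 hμ)
  obtain ⟨h1, h2⟩ := prufer_comparison h hθ.continuousOn (fun x hx => hθ.hasDerivAt hx)
    hφ.continuousOn (fun x hx => hφ.hasDerivAt hx) (fun x _ => le_rfl) (fun x _ => by
      have := le_prufer_sub h hμ.le x (φ x)
      nlinarith [sq_nonneg (Real.sin (φ x))]) ha
  refine lt_of_le_of_ne (h1 b (right_mem_Icc.2 hab.le)) fun heq => ?_
  have h3 := h2 b (right_mem_Icc.2 hab.le) heq
  have hsin : ∀ x ∈ Ioo a b, Real.sin (θ x) = 0 := by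
    intro x hx
    have h4 : HasDerivAt θ (prufer Φ μ' x (φ x)) x := by
      refine (hφ.hasDerivAt hx).congr_of_eventuallyEq ?_
      filter_upwards [Icc_mem_nhds hx.1 hx.2] with y hy using h3 y hy
    have h5 := (hθ.hasDerivAt hx).unique h4
    have h6 := le_prufer_sub h hμ.le x (θ x)
    rw [h5, h3 x (Ioo_subset_Icc_self hx), sub_self, ← h3 x (Ioo_subset_Icc_self hx)] at h6
    exact pow_eq_zero_iff two_ne_zero |>.1
      (le_antisymm (nonpos_of_mul_nonpos_right h6 hpos) (sq_nonneg _))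
  obtain ⟨x, hx⟩ := nonempty_Ioo.2 hab
  have h7 : HasDerivAt (fun y => Real.sin (θ y)) 0 x := by
    refine (hasDerivAt_const x (0 : ℝ)).congr_of_eventuallyEq ?_
    filter_upwards [Ioo_mem_nhds hx.1 hx.2] with y hy using hsin y hy
  have h8 := (hθ.hasDerivAt hx).sin.unique h7
  have h9 := Real.sin_sq_add_cos_sq (θ x)
  rw [prufer, hsin x hx] at h8
  rw [hsin x hx] at h9
  have h10 : Real.cos (θ x) = 0 := by simpa using h8
  rw [h10] at h9
  norm_num at h9

theorem hasDerivWithinAt_Ici (hθ : IsAngle Φ a b μ θ) {t : ℝ} (ht : t ∈ Ico a b) :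
    HasDerivWithinAt θ (prufer Φ μ t (θ t)) (Ici t) t :=
  (hθ t (Ico_subset_Icc_self ht)).mono_of_mem_nhdsWithin (Icc_mem_nhdsGE_of_mem ht)

theorem dist_le (h : IsNormalForm Φ A κ) {μ' : ℝ} {φ : ℝ → ℝ}
    (hθ : IsAngle Φ a b μ θ) (hφ : IsAngle Φ a b μ' φ) (ha : θ a = φ a) (hab : a ≤ b) :
    dist (θ b) (φ b) ≤ gronwallBound 0 (2 + 2 * (A * (2 + |μ|))) (A * |μ' - μ|) (b - a) := by
  have hA := h.A_nonneg
  have := dist_le_of_approx_trajectories_ODE (v := prufer Φ μ) (f := θ) (g := φ) (a := a) (b := b)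
    (K := ⟨2 + 2 * (A * (2 + |μ|)), by positivity⟩) (εf := 0) (εg := A * |μ' - μ|) (δ := 0)
    (fun t => LipschitzWith.of_dist_le_mul fun x y => abs_prufer_sub_prufer_le h μ t x y)
    hθ.continuousOn (fun t ht => hθ.hasDerivWithinAt_Ici ht) (fun t _ => by simp)
    hφ.continuousOn (fun t ht => hφ.hasDerivWithinAt_Ici ht)
    (fun t _ => abs_prufer_sub_le h μ' μ t (φ t)) (by simp [ha]) b (right_mem_Icc.2 hab)
  rwa [zero_add] at this

end IsAngle

theorem continuous_angle_right (h : IsNormalForm Φ A κ) {a b θ₀ : ℝ} (hab : a ≤ b)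
    {θ : ℝ → ℝ → ℝ} (hθ : ∀ μ, IsAngle Φ a b μ (θ μ)) (ha : ∀ μ, θ μ a = θ₀) :
    Continuous fun μ => θ μ b := by
  rw [continuous_iff_continuousAt]
  intro μ
  have h1 : Continuous fun μ' =>
      gronwallBound 0 (2 + 2 * (A * (2 + |μ|))) (A * |μ' - μ|) (b - a) :=
    (gronwallBound_continuous_ε _ _ _).comp (by fun_prop)
  have h2 := h1.tendsto μ
  simp only [sub_self, abs_zero, mul_zero, gronwallBound_ε0_δ0] at h2
  refine tendsto_iff_dist_tendsto_zero.2 (squeeze_zero (fun _ => dist_nonneg) (fun μ' => ?_) h2)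
  rw [dist_comm]
  exact (hθ μ).dist_le h (hθ μ') (by rw [ha, ha]) hab

theorem exists_angle_lt (h : IsNormalForm Φ A κ) (a b : ℝ) (hab : a ≤ b) (k : ℤ) :
    ∃ μ, ∀ θ, IsAngle Φ a b μ θ → θ a = k * Real.pi → θ b < (k + 1) * Real.pi := by
  have hA := h.A_nonneg
  have hκ := h.κ_pos
  refine ⟨-((1 + 2 * A) / κ), fun θ hθ ha => ?_⟩
  have hpi := Real.pi_pos
  set x := k * Real.pi + Real.pi / 2
  have hsin : Real.sin x ^ 2 = 1 := by
    rw [Real.sin_sq, Real.cos_add_pi_div_two, Real.sin_int_mul_pi]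
    norm_num
  have := (prufer_comparison h (φ := fun _ => x) (φ' := fun _ => 0) hθ.continuousOn
    (fun _ ht => hθ.hasDerivAt ht) continuousOn_const (fun t _ => hasDerivAt_const t _)
    (fun _ _ => le_rfl) (fun t _ => ?_) (by simp only [x]; linarith)).1 b (right_mem_Icc.2 hab)
  · simp only [x] at this
    linarith
  · have h1 := le_prufer_sub h (μ := -((1 + 2 * A) / κ)) (μ' := 0)
      (neg_nonpos.2 (by positivity)) t x
    rw [hsin, zero_sub, neg_neg, mul_one, mul_div_cancel₀ _ hκ.ne'] at h1
    have h2 := (abs_le.1 (abs_prufer_le h 0 t x)).2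
    rw [abs_zero, add_zero] at h2
    linarith

theorem cos_sq_add_mul_sin_sq_pos {l : ℝ} (hl : 0 < l) (x : ℝ) :
    0 < Real.cos x ^ 2 + l * Real.sin x ^ 2 := by
  have hsc := Real.sin_sq_add_cos_sq x
  by_cases h0 : Real.sin x = 0
  · rw [h0] at hsc ⊢
    nlinarith
  · positivity

/-- For `k > 0`, the strictly increasing change of angle `ψ` with `tan ψ = k tan θ`. -/
theorem hasDerivAt_add_arctan {k : ℝ} (hk : 0 < k) (x : ℝ) :
    HasDerivAt (fun x => x + Real.arctan ((k - 1) * (Real.sin x * Real.cos x) /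
      (Real.cos x ^ 2 + k * Real.sin x ^ 2)))
      (k / (Real.cos x ^ 2 + k ^ 2 * Real.sin x ^ 2)) x := by
  have hsc := Real.sin_sq_add_cos_sq x
  have hD := cos_sq_add_mul_sin_sq_pos hk x
  have hD2 := cos_sq_add_mul_sin_sq_pos (pow_pos hk 2) x
  have hs := Real.hasDerivAt_sin x
  have hc := Real.hasDerivAt_cos x
  convert! (hasDerivAt_id x).add ((((hs.mul hc).const_mul (k - 1)).div
    ((hc.pow 2).add ((hs.pow 2).const_mul k)) hD.ne').arctan) using 1
  simp only [Pi.mul_apply, Pi.pow_apply, Pi.add_apply, Pi.div_apply]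
  generalize Real.sin x = s at *
  generalize Real.cos x = c at *
  have hN : (c ^ 2 + k * s ^ 2) ^ 2 + ((k - 1) * (s * c)) ^ 2 = c ^ 2 + k ^ 2 * s ^ 2 := by
    have : (c ^ 2 + k * s ^ 2) ^ 2 + ((k - 1) * (s * c)) ^ 2
      = (s ^ 2 + c ^ 2) * (c ^ 2 + k ^ 2 * s ^ 2) := by ring
    rw [this, hsc, one_mul]
  have hQ : 1 + ((k - 1) * (s * c) / (c ^ 2 + k * s ^ 2)) ^ 2 =
      (c ^ 2 + k ^ 2 * s ^ 2) / (c ^ 2 + k * s ^ 2) ^ 2 := by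
    rw [← hN]
    field_simp
  rw [hQ]
  have hM : (k - 1) * (c * c + s * -s) * (c ^ 2 + k * s ^ 2) -
      (k - 1) * (s * c) * (2 * c ^ (2 - 1) * -s + k * (2 * s ^ (2 - 1) * c)) =
      (k - 1) * (c ^ 2 - k * s ^ 2) := by
    trans (s ^ 2 + c ^ 2) * ((k - 1) * (c ^ 2 - k * s ^ 2))
    · ring
    · rw [hsc, one_mul]
  simp only [Nat.cast_ofNat]
  rw [hM]
  field_simp
  trans k * (s ^ 2 + c ^ 2)
  · rw [hsc, mul_one]
  · ring

theorem half_mul_le_prufer (h : IsNormalForm Φ A κ) (k t θ : ℝ) :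
    (Real.cos θ ^ 2 + k ^ 2 * Real.sin θ ^ 2) / 2 ≤
      prufer Φ ((k ^ 2 / 2 + A + A ^ 2 / 2) / κ) t θ := by
  have hA := h.A_nonneg
  have hκ := h.κ_pos
  have h1 := le_prufer_sub h (μ := 0) (μ' := (k ^ 2 / 2 + A + A ^ 2 / 2) / κ) (by positivity) t θ
  rw [sub_zero, mul_div_cancel₀ _ hκ.ne'] at h1
  have h2 : Real.cos θ ^ 2 / 2 - (A + A ^ 2 / 2) * Real.sin θ ^ 2 ≤ prufer Φ 0 t θ := by
    unfold prufer
    have h3 := h.abs_le (Real.cos θ) (Real.sin θ) (-0 * Real.sin θ) t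
    have h4 := le_abs_self (Real.sin θ * Φ (Real.cos θ) (Real.sin θ) (-0 * Real.sin θ) t)
    rw [abs_mul] at h4
    have h5 := mul_le_mul_of_nonneg_left h3 (abs_nonneg (Real.sin θ))
    rw [neg_zero, zero_mul, abs_zero, add_zero] at h5
    rw [neg_zero, zero_mul] at h4 ⊢
    rw [← sq_abs (Real.cos θ), ← sq_abs (Real.sin θ)]
    nlinarith [sq_nonneg (|Real.cos θ| - A * |Real.sin θ|)]
  linarith

theorem exists_le_angle (h : IsNormalForm Φ A κ) {a b : ℝ} (hab : a < b) (θ₀ M : ℝ) :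
    ∃ μ, ∀ θ, IsAngle Φ a b μ θ → θ a = θ₀ → M ≤ θ b := by
  have hba : 0 < b - a := sub_pos.2 hab
  set k := 1 + 2 * (|M - θ₀| + Real.pi) / (b - a)
  have hk : 0 < k := by
    have := Real.pi_pos
    positivity
  have hkM : M - θ₀ + Real.pi ≤ k / 2 * (b - a) := by
    have : k / 2 * (b - a) = (b - a) / 2 + (|M - θ₀| + Real.pi) := by
      simp only [k]
      field_simp
    rw [this]
    linarith [le_abs_self (M - θ₀)]
  refine ⟨(k ^ 2 / 2 + A + A ^ 2 / 2) / κ, fun θ hθ ha => ?_⟩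
  set G : ℝ → ℝ := fun x => x + Real.arctan ((k - 1) * (Real.sin x * Real.cos x) /
      (Real.cos x ^ 2 + k * Real.sin x ^ 2))
  have hG : ∀ x, |G x - x| ≤ Real.pi / 2 := fun x => by
    simp only [G, add_sub_cancel_left]
    exact abs_le.2 ⟨(Real.neg_pi_div_two_lt_arctan _).le, (Real.arctan_lt_pi_div_two _).le⟩
  have hGc : Continuous G :=
    continuous_iff_continuousAt.2 fun x => (hasDerivAt_add_arctan hk x).continuousAt
  have hGd : ∀ t ∈ Ioo a b, HasDerivAt (G ∘ θ) _ t :=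
    fun t ht => (hasDerivAt_add_arctan hk (θ t)).comp t (hθ.hasDerivAt ht)
  have key : k / 2 * (b - a) ≤ G (θ b) - G (θ a) := by
    refine (convex_Icc a b).mul_sub_le_image_sub_of_le_deriv (hGc.comp_continuousOn hθ.continuousOn)
      ?_ ?_ a (left_mem_Icc.2 hab.le) b (right_mem_Icc.2 hab.le) hab.le <;> rw [interior_Icc]
    · exact fun t ht => (hGd t ht).differentiableAt.differentiableWithinAt
    · intro t ht
      have h1 := half_mul_le_prufer h k t (θ t)
      have hD := cos_sq_add_mul_sin_sq_pos (pow_pos hk 2) (θ t)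
      rw [(hGd t ht).deriv, div_mul_eq_mul_div, le_div_iff₀ hD]
      nlinarith
  have h1 := abs_le.1 (hG (θ a))
  have h2 := abs_le.1 (hG (θ b))
  rw [ha] at h1 key
  linarith

theorem IsAngle.exists_solution (h : IsNormalForm Φ A κ) {a b μ : ℝ} {θ : ℝ → ℝ} (hab : a < b)
    (hθ : IsAngle Φ a b μ θ) :
    ∃ r : ℝ → ℝ, (∀ t, 0 < r t) ∧ r a = 1 ∧
      C2Fun a b (fun t => r t * Real.sin (θ t)) (fun t => r t * Real.cos (θ t))
        (fun t => Φ (r t * Real.cos (θ t)) (r t * Real.sin (θ t))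
          (-μ * (r t * Real.sin (θ t))) t) := by
  set R : ℝ → ℝ := fun t => Real.cos (θ t) * (Real.sin (θ t) +
    Φ (Real.cos (θ t)) (Real.sin (θ t)) (-μ * Real.sin (θ t)) t)
  have hθc := hθ.continuousOn
  have hcos := Real.continuous_cos.comp_continuousOn hθc
  have hsin := Real.continuous_sin.comp_continuousOn hθc
  have hR : ContinuousOn R (Icc a b) :=
    hcos.mul (hsin.add (h.continuous_uncurry.comp_continuousOn
      (hcos.prodMk (hsin.prodMk ((continuousOn_const.mul hsin).prodMk continuousOn_id)))))
  set Re := IccExtend hab.le ((Icc a b).domRestrict R)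
  have hRe : Continuous Re := hR.domRestrict.Icc_extend'
  set r : ℝ → ℝ := fun t => Real.exp (∫ s in a..t, Re s)
  have hr : ∀ t ∈ Icc a b, HasDerivWithinAt r (r t * R t) (Icc a b) t := by
    intro t ht
    have h1 : HasDerivAt r (r t * Re t) t :=
      (hRe.integral_hasStrictDerivAt a t).hasDerivAt.exp
    rw [show Re t = R t from IccExtend_of_mem hab.le _ ht] at h1
    exact h1.hasDerivWithinAt
  have hrc : ContinuousOn r (Icc a b) := fun t ht => (hr t ht).continuousWithinAt
  refine ⟨r, fun t => Real.exp_pos _, by simp [r], ?_, hrc.mul hcos, ?_, ?_⟩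
  · intro t ht
    convert! (hr t ht).mul (hθ t ht).sin using 1
    simp only [R, prufer]
    linear_combination (-(r t * Real.cos (θ t))) * Real.sin_sq_add_cos_sq (θ t)
  · intro t ht
    have hm := Ioo_subset_Icc_self ht
    have h1 := ((hr t hm).hasDerivAt (Icc_mem_nhds ht.1 ht.2)).mul (hθ.hasDerivAt ht).cos
    convert! h1 using 1
    have h2 := h.hom (r t) (Real.exp_pos _).le (Real.cos (θ t)) (Real.sin (θ t))
      (-μ * Real.sin (θ t)) t
    simp only [R, prufer]
    rw [mul_left_comm (-μ), h2]
    linear_combination (-(r t * Φ (Real.cos (θ t)) (Real.sin (θ t)) (-μ * Real.sin (θ t)) t)) *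
      Real.sin_sq_add_cos_sq (θ t)
  · have hu := hrc.mul hsin
    exact (h.continuous_uncurry.comp_continuousOn ((hrc.mul hcos).prodMk (hu.prodMk
      ((continuousOn_const.mul hu).prodMk continuousOn_id)))).mono Ioo_subset_Icc_self

theorem IsNormalForm.eqOn_const_mul (h : IsNormalForm Φ A κ) {a b μ c : ℝ}
    {u u' u'' v v' v'' : ℝ → ℝ} (hc : 0 ≤ c)
    (hu : C2Fun a b u u' u'') (hu' : ∀ t ∈ Ioo a b, u'' t = Φ (u' t) (u t) (-μ * u t) t)
    (hv : C2Fun a b v v' v'') (hv' : ∀ t ∈ Ioo a b, v'' t = Φ (v' t) (v t) (-μ * v t) t)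
    (h0 : v a = c * u a) (h1 : v' a = c * u' a) : ∀ t ∈ Icc a b, v t = c * u t := by
  have hA := h.A_nonneg
  set w : ℝ → ℝ := fun t => -((v t - c * u t) ^ 2 + (v' t - c * u' t) ^ 2)
  have hcu : ContinuousOn u (Icc a b) := fun t ht => (hu.1 t ht).continuousWithinAt
  have hcv : ContinuousOn v (Icc a b) := fun t ht => (hv.1 t ht).continuousWithinAt
  have hw : ContinuousOn w (Icc a b) :=
    (((hcv.sub (continuousOn_const.mul hcu)).pow 2).add
      ((hv.2.1.sub (continuousOn_const.mul hu.2.1)).pow 2)).neg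
  have hw' : ∀ t ∈ Ioo a b, HasDerivAt w (-(2 * (v t - c * u t) * (v' t - c * u' t) +
      2 * (v' t - c * u' t) * (v'' t - c * u'' t))) t := by
    intro t ht
    have hn := Icc_mem_nhds ht.1 ht.2
    have hm := Ioo_subset_Icc_self ht
    convert! ((((hv.1 t hm).hasDerivAt hn).sub (((hu.1 t hm).hasDerivAt hn).const_mul c)).pow 2
      |>.add (((hv.2.2.1 t ht).sub ((hu.2.2.1 t ht).const_mul c)).pow 2)).neg using 1
    simp
  have hle : ∀ t ∈ Ioo a b, -((1 + 2 * A + A * (1 + |μ|)) * |w t|) ≤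
      -(2 * (v t - c * u t) * (v' t - c * u' t) +
      2 * (v' t - c * u' t) * (v'' t - c * u'' t)) := by
    intro t ht
    have h2 : |v'' t - c * u'' t| ≤
        A * (|v' t - c * u' t| + (1 + |μ|) * |v t - c * u t|) := by
      rw [hv' t ht, hu' t ht, ← h.hom c hc]
      refine (h.lip _ _ _ _ _ _ _).trans (mul_le_mul_of_nonneg_left ?_ hA)
      rw [mul_left_comm c, ← mul_sub, abs_mul, abs_neg]
      linarith
    have hE : 0 ≤ (v t - c * u t) ^ 2 + (v' t - c * u' t) ^ 2 := by positivity
    rw [show |w t| = |v t - c * u t| ^ 2 + |v' t - c * u' t| ^ 2 by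
      simp only [w]
      rw [abs_neg, abs_of_nonneg hE, sq_abs, sq_abs]]
    have h3 := le_abs_self ((v t - c * u t) * (v' t - c * u' t))
    have h4 := le_abs_self ((v' t - c * u' t) * (v'' t - c * u'' t))
    rw [abs_mul] at h3 h4
    generalize |v t - c * u t| = x at *
    generalize hy : |v' t - c * u' t| = y at *
    have hy0 : 0 ≤ y := hy ▸ abs_nonneg _
    have h5 := mul_le_mul_of_nonneg_left h2 hy0
    have h6 : 0 ≤ A * (1 + |μ|) := by positivity
    nlinarith [sq_nonneg (x - y), mul_nonneg h6 (sq_nonneg (x - y)), mul_nonneg hA (sq_nonneg x)]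
  have hw0 := nonneg_of_neg_mul_abs_le_deriv hw hw' hle (by simp [w, h0, h1])
  intro t ht
  have h2 : 0 ≤ -((v t - c * u t) ^ 2 + (v' t - c * u' t) ^ 2) := hw0 t ht
  have h3 : (v t - c * u t) ^ 2 = 0 := by
    nlinarith [sq_nonneg (v t - c * u t), sq_nonneg (v' t - c * u' t)]
  linarith [pow_eq_zero_iff two_ne_zero |>.1 h3]

theorem IsAngle.hasNodalStructure (h : IsNormalForm Φ A κ) {a b μ : ℝ} {θ r : ℝ → ℝ} (hab : a < b)
    (hθ : IsAngle Φ a b μ θ) (hr : ∀ t, 0 < r t) (k n : ℕ) (ha : θ a = k * Real.pi)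
    (hb : θ b = (k + n + 1 : ℕ) * Real.pi) :
    HasNodalStructure a b n ((-1) ^ k) (fun t => r t * Real.sin (θ t)) := by
  have hpi := Real.pi_pos
  have hex : ∀ i : ℕ, ∃ z, i ≤ n + 1 → z ∈ Icc a b ∧ θ z = (k + i : ℕ) * Real.pi := by
    intro i
    by_cases hi : i ≤ n + 1
    · obtain ⟨z, hz, hz'⟩ := intermediate_value_Icc hab.le hθ.continuousOn
        (show ((k + i : ℕ) : ℝ) * Real.pi ∈ Icc _ _ by
          rw [ha, hb]
          constructor <;>
            exact mul_le_mul_of_nonneg_right (Nat.cast_le.2 (by omega)) hpi.le)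
      exact ⟨z, fun _ => ⟨hz, hz'⟩⟩
    · exact ⟨0, fun h => absurd h hi⟩
  choose z hz using hex
  have hbar : ∀ {s t : ℝ} (m : ℕ), a ≤ s → s < t → t ≤ b → (m : ℝ) * Real.pi ≤ θ s →
      (m : ℝ) * Real.pi < θ t := by
    intro s t m hs hst ht hm
    simpa using hθ.int_mul_pi_lt h hs hst ht (k := m) (by simpa using hm)
  have hgt : ∀ i ≤ n + 1, ∀ t ≤ b, z i < t → (k + i : ℕ) * Real.pi < θ t :=
    fun i hi t ht hit => hbar _ (hz i hi).1.1 hit ht (hz i hi).2.ge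
  have hlt : ∀ i ≤ n + 1, ∀ t, a ≤ t → t < z i → θ t < (k + i : ℕ) * Real.pi := by
    intro i hi t ht hit
    by_contra hcon
    push Not at hcon
    exact absurd (hz i hi).2 (hbar _ ht hit (hz i hi).1.2 hcon).ne'
  have hz0 : z 0 = a := by
    refine le_antisymm ?_ (hz 0 (by omega)).1.1
    by_contra hcon
    push Not at hcon
    have := hlt 0 (by omega) a le_rfl hcon
    rw [ha, add_zero] at this
    exact lt_irrefl _ this
  have hzn : z (n + 1) = b := by
    refine le_antisymm (hz (n + 1) le_rfl).1.2 ?_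
    by_contra hcon
    push Not at hcon
    have := hgt (n + 1) le_rfl b le_rfl hcon
    rw [hb, add_assoc] at this
    exact lt_irrefl _ this
  refine ⟨z, hz0, hzn, ?_, ?_, ?_⟩
  · intro i hi
    by_contra hcon
    push Not at hcon
    have h1 : ((k + (i + 1) : ℕ) : ℝ) * Real.pi ≤ (k + i : ℕ) * Real.pi := by
      rcases hcon.eq_or_lt with heq | hlt'
      · rw [← (hz i (by omega)).2, ← (hz (i + 1) (by omega)).2, heq]
      · have := hgt (i + 1) (by omega) (z i) (hz i (by omega)).1.2 hlt'
        rw [(hz i (by omega)).2] at this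
        exact this.le
    have h2 := le_of_mul_le_mul_right h1 hpi
    norm_cast at h2
    omega
  · intro t ht
    rw [mul_eq_zero, or_iff_right (hr t).ne']
    constructor
    · intro hs
      obtain ⟨m, hm⟩ := Real.sin_eq_zero_iff.1 hs
      have h1 := hgt 0 (by omega) t ht.2.le (hz0.symm ▸ ht.1)
      have h2 := hlt (n + 1) le_rfl t ht.1.le (hzn.symm ▸ ht.2)
      rw [← hm] at h1 h2
      have h3 := lt_of_mul_lt_mul_right h1 hpi.le
      have h4 := lt_of_mul_lt_mul_right h2 hpi.le
      norm_cast at h3 h4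
      obtain ⟨i, rfl⟩ : ∃ i : ℕ, m = ((k + i : ℕ) : ℤ) := ⟨(m - k).toNat, by omega⟩
      refine ⟨i, by omega, by omega, ?_⟩
      rw [Int.cast_natCast] at hm
      rcases lt_trichotomy t (z i) with hti | hti | hti
      · exact absurd hm (hlt i (by omega) t ht.1.le hti).ne'
      · exact hti
      · exact absurd hm (hgt i (by omega) t ht.2.le hti).ne
    · rintro ⟨i, hi, hin, rfl⟩
      rw [(hz i (by omega)).2]
      exact Real.sin_nat_mul_pi _
  · intro i hi t ht
    have hta : a ≤ t := (hz i (by omega)).1.1.trans ht.1.le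
    have htb : t ≤ b := ht.2.le.trans (hz (i + 1) (by omega)).1.2
    have h1 := hgt i (by omega) t htb ht.1
    have h2 := hlt (i + 1) (by omega) t hta ht.2
    have h3 : 0 < Real.sin (θ t - (k + i : ℕ) * Real.pi) := by
      refine Real.sin_pos_of_pos_of_lt_pi (by linarith) ?_
      push_cast at h2 ⊢
      linarith
    rw [Real.sin_sub_nat_mul_pi, pow_add] at h3
    have := mul_pos (hr t) h3
    linarith

theorem HasNodalStructure.exists_ne_zero {a b sgn : ℝ} {n : ℕ} {u : ℝ → ℝ} (hab : a < b)
    (hu : HasNodalStructure a b n sgn u) : ∃ t ∈ Icc a b, u t ≠ 0 := by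
  obtain ⟨z, hz0, -, hz, -, hsgn⟩ := hu
  obtain ⟨t, ht⟩ := nonempty_Ioo.2 (lt_min hab (hz0 ▸ hz 0 n.zero_le))
  refine ⟨t, ⟨ht.1.le, ht.2.le.trans (min_le_left _ _)⟩, fun h0 => ?_⟩
  have := hsgn 0 n.zero_le t ⟨hz0.symm ▸ ht.1, ht.2.trans_le (min_le_right _ _)⟩
  rw [h0, mul_zero] at this
  exact lt_irrefl _ this

theorem IsNormalForm.exists_spectral_branch (h : IsNormalForm Φ A κ) {a b : ℝ} (hab : a < b)
    {F : ℝ → ℝ → ℝ → ℝ → ℝ}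
    (hF : ∀ t ∈ Icc a b, ∀ m p u r, F m p u t = r ↔ m = Φ p u r t) (k : ℕ) :
    ∃ l : ℕ → ℝ, ∃ u u' u'' : ℕ → ℝ → ℝ, StrictMono l ∧
      (∀ n, IsEigenpair F a b (l n) (u n) (u' n) (u'' n) ∧
        HasNodalStructure a b n ((-1) ^ k) (u n)) ∧
      ∀ μ : ℝ, ∀ v v' v'' : ℝ → ℝ, IsEigenpair F a b μ v v' v'' → 0 < (-1) ^ k * v' a →
        ∃ n, μ = l n ∧ ∃ c : ℝ, ∀ t ∈ Icc a b, v t = c * u n t := by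
  have hpi := Real.pi_pos
  choose θ hθa hθ using fun μ => exists_isAngle h hab μ (k * Real.pi)
  choose r hr hra hrC using fun μ => (hθ μ).exists_solution h hab
  have hmono : StrictMono fun μ => θ μ b := fun μ μ' hμ =>
    (hθ μ).lt_of_lt h hab (hθ μ') hμ (by rw [hθa, hθa])
  have hcont := continuous_angle_right h hab.le hθ hθa
  have hex : ∀ n : ℕ, ∃ μ, θ μ b = (k + n + 1 : ℕ) * Real.pi := by
    intro n
    obtain ⟨μ₁, h1⟩ := exists_angle_lt h a b hab.le k
    obtain ⟨μ₂, h2⟩ := exists_le_angle h hab (k * Real.pi) ((k + n + 1 : ℕ) * Real.pi)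
    refine mem_range_of_exists_le_of_exists_ge hcont ⟨μ₁, ?_⟩ ⟨μ₂, h2 _ (hθ _) (hθa _)⟩
    refine (h1 _ (hθ _) (by simpa using hθa μ₁)).le.trans ?_
    gcongr
    push_cast
    linarith [(Nat.cast_nonneg n : (0 : ℝ) ≤ n)]
  choose l hl using hex
  refine ⟨l, fun n t => r (l n) t * Real.sin (θ (l n) t),
    fun n t => r (l n) t * Real.cos (θ (l n) t), _, ?_, fun n => ⟨⟨hrC (l n), ?_, ?_, ?_⟩, ?_⟩, ?_⟩
  · intro m n hmn
    rw [← hmono.lt_iff_lt]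
    simp only [hl]
    gcongr
  · exact fun t ht => (hF t (Ioo_subset_Icc_self ht) _ _ _ _).2 rfl
  · simp [hθa, Real.sin_nat_mul_pi]
  · simp only [hl, Real.sin_nat_mul_pi, mul_zero]
  · exact (hθ (l n)).hasNodalStructure h hab (hr (l n)) k n (hθa _) (hl n)
  · intro μ v v' v'' hv hpos
    obtain ⟨hvC, hvF, hva, hvb⟩ := hv
    have hvu := h.eqOn_const_mul hpos.le (hrC μ) (fun t _ => rfl) hvC
      (fun t ht => (hF t (Ioo_subset_Icc_self ht) _ _ _ _).1 (hvF t ht))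
      (by simp [hva, hθa, Real.sin_nat_mul_pi])
      (by
        rw [hra, hθa, Real.cos_nat_mul_pi, one_mul, mul_right_comm, ← mul_pow]
        norm_num)
    have hb := hvu b (right_mem_Icc.2 hab.le)
    rw [hvb, eq_comm, mul_eq_zero, or_iff_right hpos.ne', mul_eq_zero,
      or_iff_right (hr μ b).ne'] at hb
    obtain ⟨m, hm⟩ := Real.sin_eq_zero_iff.1 hb
    have hlt := (hθ μ).int_mul_pi_lt h le_rfl hab le_rfl (k := k) (by simp [hθa])
    rw [← hm] at hlt
    have hkm := lt_of_mul_lt_mul_right hlt hpi.le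
    norm_cast at hkm
    obtain ⟨n, rfl⟩ : ∃ n : ℕ, m = ((k + n + 1 : ℕ) : ℤ) := ⟨(m - k - 1).toNat, by omega⟩
    have hμ : μ = l n := hmono.injective (by simpa only [hl, Int.cast_natCast] using hm.symm)
    subst hμ
    exact ⟨n, rfl, _, hvu⟩

end Prufer

/-- the complete one-dimensional spectrum: two increasing sequences of
eigenvalues with eigenfunctions having exactly `n` interior sign-changing zeros,
and every eigenpair belongs (up to scalar multiple) to these sequences. -/
theorem stmt_10
    (a b lam Lam gam del : ℝ) (hab : a < b)
    (hlam : 0 < lam) (hLam : lam ≤ Lam) (hgam : 0 < gam) (hdel : 0 < del)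
    (F : ℝ → ℝ → ℝ → ℝ → ℝ)
    (hFcont : ContinuousOn (fun z : ℝ × ℝ × ℝ × ℝ => F z.1 z.2.1 z.2.2.1 z.2.2.2)
      {z : ℝ × ℝ × ℝ × ℝ | z.2.2.2 ∈ Icc a b})
    (hF1 : ∀ s : ℝ, 0 ≤ s → ∀ m p u : ℝ, ∀ t ∈ Icc a b,
      F (s * m) (s * p) (s * u) t = s * F m p u t)
    (hF2 : ∀ m p u m' p' u' : ℝ, ∀ t ∈ Icc a b,
      lam * max (m - m') 0 - Lam * max (-(m - m')) 0 - gam * |p - p'| - del * |u - u'|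
          ≤ F m p u t - F m' p' u' t ∧
        F m p u t - F m' p' u' t
          ≤ Lam * max (m - m') 0 - lam * max (-(m - m')) 0 + gam * |p - p'| + del * |u - u'|)
    (hF3 : ∀ m p u m' p' u' : ℝ, ∀ t ∈ Icc a b,
      -F (m' - m) (p' - p) (u' - u) t ≤ F m p u t - F m' p' u' t ∧
        F m p u t - F m' p' u' t ≤ F (m - m') (p - p') (u - u') t) :
    ∃ lamP lamM : ℕ → ℝ, ∃ uP uP' uP'' uM uM' uM'' : ℕ → ℝ → ℝ,
      StrictMono lamP ∧ StrictMono lamM ∧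
      (∀ n : ℕ,
        IsEigenpair F a b (lamP n) (uP n) (uP' n) (uP'' n) ∧
        (∃ t ∈ Icc a b, uP n t ≠ 0) ∧
        HasNodalStructure a b n 1 (uP n) ∧
        IsEigenpair F a b (lamM n) (uM n) (uM' n) (uM'' n) ∧
        (∃ t ∈ Icc a b, uM n t ≠ 0) ∧
        HasNodalStructure a b n (-1) (uM n)) ∧
      (∀ μ : ℝ, ∀ v v' v'' : ℝ → ℝ,
        IsEigenpair F a b μ v v' v'' → (∃ t ∈ Icc a b, v t ≠ 0) →
        ∃ n : ℕ,
          (μ = lamP n ∧ ∃ c : ℝ, ∀ t ∈ Icc a b, v t = c * uP n t) ∨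
          (μ = lamM n ∧ ∃ c : ℝ, ∀ t ∈ Icc a b, v t = c * uM n t)) := by
  obtain ⟨Φ, A, κ, h, hF⟩ := exists_isNormalForm hab hlam hLam hgam hdel hFcont hF1 hF2
  obtain ⟨lP, uP, uP', uP'', hlP, hP, hPc⟩ := h.exists_spectral_branch hab hF 0
  obtain ⟨lM, uM, uM', uM'', hlM, hM, hMc⟩ := h.exists_spectral_branch hab hF 1
  rw [pow_zero] at hP hPc
  rw [pow_one] at hM hMc
  refine ⟨lP, lM, uP, uP', uP'', uM, uM', uM'', hlP, hlM, fun n =>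
    ⟨(hP n).1, (hP n).2.exists_ne_zero hab, (hP n).2, (hM n).1, (hM n).2.exists_ne_zero hab,
      (hM n).2⟩, fun μ v v' v'' hv hne => ?_⟩
  rcases lt_trichotomy (v' a) 0 with hneg | h0 | hpos
  · obtain ⟨n, hn⟩ := hMc μ v v' v'' hv (by linarith)
    exact ⟨n, Or.inr hn⟩
  · obtain ⟨t, ht, hvt⟩ := hne
    have hv' : ∀ t ∈ Ioo a b, v'' t = Φ (v' t) (v t) (-μ * v t) t :=
      fun t ht => (hF t (Ioo_subset_Icc_self ht) _ _ _ _).1 (hv.2.1 t ht)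
    have := h.eqOn_const_mul le_rfl hv.1 hv' hv.1 hv' (by simp [hv.2.2.1]) (by simp [h0]) t ht
    exact absurd (by simpa using this) hvt
  · obtain ⟨n, hn⟩ := hPc μ v v' v'' hv (by linarith)
    exact ⟨n, Or.inl hn⟩
end

section
/- (Complete radial spectrum in the ball.) Assume 𝓕 satisfies (F1), (F2) and (F3). Then the radial eigenvalue problem 𝓕(u''(r), u'(r)/r, u'(r), u(r), r) = −μ·u(r) on (0,R), u'(0) = 0, u(R) = 0, admits two sequences of solution pairs {(λₙ⁺, uₙ⁺)}_{n≥0} and {(λₙ⁻, uₙ⁻)}_{n≥0} with uₙ± ∈ C²(0,R) ∩ C¹([0,R]) not identically zero, such that: uₙ⁺ and uₙ⁻ each have exactly n zeros r₁ < ... < rₙ in the open interval (0,R); uₙ⁺ (resp. uₙ⁻) is positive (resp. negative) on (0,r₁) and changes sign at each interior zero (so it alternates sign on consecutive intervals (r_i, r_{i+1})); the sequences (λₙ⁺) and (λₙ⁻) are strictly increasing in n; and the family is complete: every pair (μ, u) with u ∈ C²(0,R) ∩ C¹([0,R]) not identically zero solving the eigenvalue problem satisfies, for some n, either μ = λₙ⁺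 and u is a scalar multiple of uₙ⁺, or μ = λₙ⁻ and u is a scalar multiple of uₙ⁻. -/
open Set

/-- The radial Pucci-type maximal operator `P⁺(x,y) = Λ(x⁺+(N-1)y⁺) - λ(x⁻+(N-1)y⁻)`. -/
noncomputable def Pplus (N : ℕ) (lam Lam : ℝ) (x y : ℝ) : ℝ :=
  Lam * (max x 0 + ((N : ℝ) - 1) * max y 0) - lam * (max (-x) 0 + ((N : ℝ) - 1) * max (-y) 0)

/-- The radial Pucci-type minimal operator `P⁻(x,y) = λ(x⁺+(N-1)y⁺) - Λ(x⁻+(N-1)y⁻)`. -/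
noncomputable def Pminus (N : ℕ) (lam Lam : ℝ) (x y : ℝ) : ℝ :=
  lam * (max x 0 + ((N : ℝ) - 1) * max y 0) - Lam * (max (-x) 0 + ((N : ℝ) - 1) * max (-y) 0)

/-- `u ∈ C²(e,R) ∩ C¹([e,R])`, with first derivative `u'` (one-sided at the endpoints)
and second derivative `u''` on the open interval. -/
def RadC2 (e R : ℝ) (u u' u'' : ℝ → ℝ) : Prop :=
  (∀ r ∈ Set.Icc e R, HasDerivWithinAt u (u' r) (Set.Icc e R) r) ∧
  ContinuousOn u' (Set.Icc e R) ∧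
  (∀ r ∈ Set.Ioo e R, HasDerivAt u' (u'' r) r) ∧
  ContinuousOn u'' (Set.Ioo e R)

/-- `(μ,u)` is a radial eigenpair on the ball of radius `R`. -/
def RadEigenSol (FF : ℝ → ℝ → ℝ → ℝ → ℝ → ℝ) (R μ : ℝ) (u u' u'' : ℝ → ℝ) : Prop :=
  RadC2 0 R u u' u'' ∧
  (∀ r ∈ Set.Ioo (0 : ℝ) R, FF (u'' r) (u' r / r) (u' r) (u r) r = -μ * u r) ∧
  u' 0 = 0 ∧ u R = 0

/-- `u` has exactly `n` interior zeros `z 1 < ... < z n` in `(0,R)` (with `z 0 = 0`,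
`z (n+1) = R`) and on the nodal interval `(z i, z (i+1))` its sign is `sgn·(-1)^i`. -/
def RadNodalStructure (R : ℝ) (n : ℕ) (sgn : ℝ) (u : ℝ → ℝ) : Prop :=
  ∃ z : ℕ → ℝ, z 0 = 0 ∧ z (n + 1) = R ∧
    (∀ i : ℕ, i ≤ n → z i < z (i + 1)) ∧
    (∀ r ∈ Set.Ioo (0 : ℝ) R, (u r = 0 ↔ ∃ i : ℕ, 1 ≤ i ∧ i ≤ n ∧ r = z i)) ∧
    (∀ i : ℕ, i ≤ n → ∀ r ∈ Set.Ioo (z i) (z (i + 1)), 0 < sgn * (-1 : ℝ) ^ i * u r)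

/-! ### Existence for the singular initial value problem -/

/-- The state `u = 1 + ∫ τ w(τ) dτ` recovered from `w = u' / r`. -/
noncomputable def radPrim (w : ℝ → ℝ) (r : ℝ) : ℝ := 1 + ∫ τ in (0 : ℝ)..r, τ * w τ

/-- The weighted average `∫₀¹ tᴷ g(w, s w, u, s) dt`, `s = r t`, whose fixed points solve
`(r ^ (K + 1) w)' = r ^ K g(w, r w, u, r)`. -/
noncomputable def radAvg (K : ℕ) (g : ℝ → ℝ → ℝ → ℝ → ℝ) (w : ℝ → ℝ) (r : ℝ) : ℝ :=
  ∫ t in (0 : ℝ)..1, t ^ K * g (w (r * t)) (r * t * w (r * t)) (radPrim w (r * t)) (r * t)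

theorem continuous_radPrim {w : ℝ → ℝ → ℝ} (hw : Continuous (Function.uncurry w)) :
    Continuous (fun x : ℝ × ℝ => radPrim (w x.1) x.2) := by
  unfold radPrim
  refine continuous_const.add ?_
  apply intervalIntegral.continuous_parametric_intervalIntegral_of_continuous
    (f := fun (x : ℝ × ℝ) τ => τ * w x.1 τ) _ continuous_snd
  have : Continuous fun z : (ℝ × ℝ) × ℝ => w z.1.1 z.2 :=
    hw.comp (continuous_fst.fst.prodMk continuous_snd)
  exact continuous_snd.mul this

theorem continuous_radAvg {K : ℕ} {g : ℝ → ℝ → ℝ → ℝ → ℝ → ℝ}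
    (hg : Continuous fun z : ℝ × ℝ × ℝ × ℝ × ℝ => g z.1 z.2.1 z.2.2.1 z.2.2.2.1 z.2.2.2.2)
    {w : ℝ → ℝ → ℝ} (hw : Continuous (Function.uncurry w)) :
    Continuous (fun x : ℝ × ℝ => radAvg K (g x.1) (w x.1) x.2) := by
  unfold radAvg
  apply intervalIntegral.continuous_parametric_intervalIntegral_of_continuous'
  have hs : Continuous fun z : (ℝ × ℝ) × ℝ => z.1.2 * z.2 := by fun_prop
  have h1 : Continuous fun z : (ℝ × ℝ) × ℝ => w z.1.1 (z.1.2 * z.2) :=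
    hw.comp (continuous_fst.fst.prodMk hs)
  have h2 : Continuous fun z : (ℝ × ℝ) × ℝ => radPrim (w z.1.1) (z.1.2 * z.2) :=
    (continuous_radPrim hw).comp (continuous_fst.fst.prodMk hs)
  exact (continuous_snd.pow K).mul
    (hg.comp (continuous_fst.fst.prodMk (h1.prodMk ((hs.mul h1).prodMk (h2.prodMk hs)))))

theorem integral_mul_exp_le {ω : ℝ} (hω : 0 < ω) (s : ℝ) :
    ∫ τ in (0 : ℝ)..s, Real.exp (ω * τ) ≤ Real.exp (ω * s) / ω := by
  have h : ∀ x ∈ uIcc 0 s, HasDerivAt (fun τ => Real.exp (ω * τ) / ω) (Real.exp (ω * x)) x := by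
    intro x _
    have := (((hasDerivAt_id x).const_mul ω).exp).div_const ω
    simpa [hω.ne'] using this
  rw [intervalIntegral.integral_eq_sub_of_hasDerivAt h
    (Continuous.intervalIntegrable (by fun_prop) _ _)]
  have : 0 < Real.exp (ω * 0) / ω := by positivity
  linarith

theorem abs_radPrim_sub_le {w₁ w₂ : ℝ → ℝ} (h₁ : Continuous w₁) (h₂ : Continuous w₂)
    {R M ω : ℝ} (hω : 0 < ω) (hM : 0 ≤ M)
    (h : ∀ s ∈ Icc 0 R, |w₁ s - w₂ s| ≤ M * Real.exp (ω * s)) {s : ℝ} (hs : s ∈ Icc 0 R) :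
    |radPrim w₁ s - radPrim w₂ s| ≤ R * M * Real.exp (ω * s) / ω := by
  have hR : 0 ≤ R := hs.1.trans hs.2
  have e : radPrim w₁ s - radPrim w₂ s = ∫ τ in (0 : ℝ)..s, τ * (w₁ τ - w₂ τ) := by
    unfold radPrim
    rw [add_sub_add_left_eq_sub, ← intervalIntegral.integral_sub]
    · simp only [mul_sub]
    · exact Continuous.intervalIntegrable (by fun_prop) _ _
    · exact Continuous.intervalIntegrable (by fun_prop) _ _
  rw [e, ← Real.norm_eq_abs]
  calc _ ≤ ∫ τ in (0 : ℝ)..s, R * M * Real.exp (ω * τ) := by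
        refine intervalIntegral.norm_integral_le_of_norm_le hs.1
          (Filter.Eventually.of_forall fun τ hτ => ?_)
          (Continuous.intervalIntegrable (by fun_prop) _ _)
        have hτ' : τ ∈ Icc 0 R := ⟨hτ.1.le, hτ.2.trans hs.2⟩
        rw [Real.norm_eq_abs, abs_mul, abs_of_nonneg hτ'.1, mul_assoc]
        exact mul_le_mul hτ'.2 (h τ hτ') (abs_nonneg _) hR
    _ ≤ _ := by
        rw [intervalIntegral.integral_const_mul, mul_div_assoc]
        exact mul_le_mul_of_nonneg_left (integral_mul_exp_le hω s) (by positivity)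

theorem integral_mul_exp_mul_le {ω r : ℝ} (hω : 0 < ω) (hr : 0 ≤ r) :
    ∫ t in (0 : ℝ)..1, r * Real.exp (ω * (r * t)) ≤ Real.exp (ω * r) / ω := by
  rw [intervalIntegral.integral_const_mul]
  rcases hr.eq_or_lt with rfl | hr
  · simp; positivity
  · rw [intervalIntegral.integral_comp_mul_left (fun x => Real.exp (ω * x)) hr.ne']
    have := integral_mul_exp_le hω r
    simpa [hr.ne'] using this

theorem continuous_radAvg_integrand {K : ℕ} {g : ℝ → ℝ → ℝ → ℝ → ℝ}
    (hg : Continuous fun z : ℝ × ℝ × ℝ × ℝ => g z.1 z.2.1 z.2.2.1 z.2.2.2)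
    {w : ℝ → ℝ} (hw : Continuous w) (r : ℝ) :
    Continuous fun t =>
      t ^ K * g (w (r * t)) (r * t * w (r * t)) (radPrim w (r * t)) (r * t) := by
  have hp : Continuous (radPrim w) :=
    (continuous_radPrim (w := fun _ => w) (hw.comp continuous_snd)).comp
      (continuous_const.prodMk continuous_id : Continuous fun r : ℝ => ((0 : ℝ), r))
  have hs : Continuous fun t : ℝ => r * t := by fun_prop
  have h1 := hw.comp hs
  exact (continuous_id.pow K).mul
    (hg.comp (h1.prodMk ((hs.mul h1).prodMk ((hp.comp hs).prodMk hs))))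

theorem abs_radAvg_sub_le {K : ℕ} {B b R M ω : ℝ} (hB : 0 ≤ B) (hb : 0 ≤ b) (hω : 0 < ω)
    (hM : 0 ≤ M) {g : ℝ → ℝ → ℝ → ℝ → ℝ}
    (hg : Continuous fun z : ℝ × ℝ × ℝ × ℝ => g z.1 z.2.1 z.2.2.1 z.2.2.2)
    (hlip : ∀ l p u l' p' u' r,
      |g l p u r - g l' p' u' r| ≤ K * |l - l'| + B * |p - p'| + b * |u - u'|)
    {w₁ w₂ : ℝ → ℝ} (h₁ : Continuous w₁) (h₂ : Continuous w₂)
    (h : ∀ s ∈ Icc 0 R, |w₁ s - w₂ s| ≤ M * Real.exp (ω * s)) {r : ℝ} (hr : r ∈ Icc 0 R) :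
    |radAvg K g w₁ r - radAvg K g w₂ r| ≤
      M * Real.exp (ω * r) * (K / (K + 1) + B / ω + b * R / ω) := by
  have hR : 0 ≤ R := hr.1.trans hr.2
  unfold radAvg
  rw [← intervalIntegral.integral_sub
    ((continuous_radAvg_integrand hg h₁ r).intervalIntegrable _ _)
    ((continuous_radAvg_integrand hg h₂ r).intervalIntegrable _ _), ← Real.norm_eq_abs]
  calc _ ≤ ∫ t in (0 : ℝ)..1, (K * (M * Real.exp (ω * r)) * t ^ K
          + B * M * (r * Real.exp (ω * (r * t))) + b * (R * M * Real.exp (ω * r) / ω)) := by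
        refine intervalIntegral.norm_integral_le_of_norm_le zero_le_one
          (Filter.Eventually.of_forall fun t ht => ?_)
          (Continuous.intervalIntegrable (by fun_prop) _ _)
        have ht0 : 0 ≤ t := ht.1.le
        have hle : r * t ≤ r := mul_le_of_le_one_right hr.1 ht.2
        have hs : r * t ∈ Icc 0 R := ⟨mul_nonneg hr.1 ht0, hle.trans hr.2⟩
        have hexp : Real.exp (ω * (r * t)) ≤ Real.exp (ω * r) :=
          Real.exp_le_exp.2 (mul_le_mul_of_nonneg_left hle hω.le)
        have hw := h _ hs
        have hu := abs_radPrim_sub_le h₁ h₂ hω hM h hs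
        rw [Real.norm_eq_abs, ← mul_sub, abs_mul, abs_of_nonneg (pow_nonneg ht0 K)]
        have htK : t ^ K ≤ 1 := pow_le_one₀ ht0 ht.2
        have htK0 : 0 ≤ t ^ K := pow_nonneg ht0 K
        have hg' := hlip (w₁ (r * t)) (r * t * w₁ (r * t)) (radPrim w₁ (r * t))
          (w₂ (r * t)) (r * t * w₂ (r * t)) (radPrim w₂ (r * t)) (r * t)
        rw [← mul_sub, abs_mul (r * t), abs_of_nonneg hs.1] at hg'
        have e1 : (K : ℝ) * |w₁ (r * t) - w₂ (r * t)| ≤ K * (M * Real.exp (ω * r)) := by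
          gcongr; exact hw.trans (by gcongr)
        have e2 : B * (r * t * |w₁ (r * t) - w₂ (r * t)|)
            ≤ B * M * (r * Real.exp (ω * (r * t))) := by
          calc _ ≤ B * (r * (M * Real.exp (ω * (r * t)))) := by
                have := hr.1
                gcongr
            _ = _ := by ring
        have e3 : b * |radPrim w₁ (r * t) - radPrim w₂ (r * t)|
            ≤ b * (R * M * Real.exp (ω * r) / ω) := by
          gcongr; exact hu.trans (by gcongr)
        have p2 : 0 ≤ B * M * (r * Real.exp (ω * (r * t))) := by have := hr.1; positivity
        have p3 : 0 ≤ b * (R * M * Real.exp (ω * r) / ω) := by positivity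
        calc t ^ K * _ ≤ t ^ K * (K * (M * Real.exp (ω * r))
              + B * M * (r * Real.exp (ω * (r * t))) + b * (R * M * Real.exp (ω * r) / ω)) := by
              apply mul_le_mul_of_nonneg_left _ htK0
              linarith
          _ ≤ _ := by nlinarith
    _ ≤ _ := by
        rw [intervalIntegral.integral_add, intervalIntegral.integral_add,
          intervalIntegral.integral_const_mul, intervalIntegral.integral_const_mul, integral_pow,
          intervalIntegral.integral_const]
        · have := integral_mul_exp_mul_le hω hr.1
          have h2 : B * M * (∫ t in (0 : ℝ)..1, r * Real.exp (ω * (r * t)))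
              ≤ B * M * (Real.exp (ω * r) / ω) := by gcongr
          have h3 : (K : ℝ) * (M * Real.exp (ω * r)) * ((1 ^ (K + 1) - 0 ^ (K + 1)) / (K + 1))
              = M * Real.exp (ω * r) * (K / (K + 1)) := by
            simp; ring
          rw [h3]
          calc _ ≤ M * Real.exp (ω * r) * (K / (K + 1)) + B * M * (Real.exp (ω * r) / ω)
                + (1 - 0 : ℝ) • (b * (R * M * Real.exp (ω * r) / ω)) := by gcongr
            _ = _ := by simp; ring
        all_goals exact Continuous.intervalIntegrable (by fun_prop) _ _

/-- Clamping of a radius to `[0,R]`. -/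
noncomputable def clampRadius (R r : ℝ) : ℝ := max 0 (min r R)

theorem clampRadius_mem {R : ℝ} (hR : 0 ≤ R) (r : ℝ) : clampRadius R r ∈ Icc 0 R :=
  ⟨le_max_left _ _, max_le hR (min_le_right _ _)⟩

theorem clampRadius_of_mem {R r : ℝ} (hr : r ∈ Icc 0 R) : clampRadius R r = r := by
  simp [clampRadius, hr.1, hr.2]

theorem continuous_clampRadius (R : ℝ) : Continuous (clampRadius R) := by
  unfold clampRadius; fun_prop

/-- A family of solutions of the fixed point equation for `radAvg`, jointly continuous in the
parameter and the radius. -/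
theorem exists_radAvg_fixedPoint (K : ℕ) {R B : ℝ} (hR : 0 ≤ R) (hB : 0 ≤ B)
    {g : ℝ → ℝ → ℝ → ℝ → ℝ → ℝ}
    (hg : Continuous fun z : ℝ × ℝ × ℝ × ℝ × ℝ => g z.1 z.2.1 z.2.2.1 z.2.2.2.1 z.2.2.2.2)
    (hlip : ∀ μ l p u l' p' u' r, |g μ l p u r - g μ l' p' u' r| ≤
      K * |l - l'| + B * |p - p'| + B * (1 + |μ|) * |u - u'|)
    (hzero : ∀ μ r, g μ 0 0 0 r = 0) :
    ∃ w : ℝ → ℝ → ℝ, Continuous (Function.uncurry w) ∧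
      ∀ μ, ∀ r ∈ Icc 0 R, w μ r = radAvg K (g μ) (w μ) r := by
  set L : ℝ := 2 * (K + 1) * (B + B * R + 1) with hL
  have hLpos : 0 < L := by positivity
  set a : ℝ → ℝ := fun μ => 1 + |μ| with ha
  have ha1 : ∀ μ, 1 ≤ a μ := fun μ => by simp [ha]
  have ha0 : ∀ μ, 0 < a μ := fun μ => zero_lt_one.trans_le (ha1 μ)
  have hac : Continuous a := by fun_prop
  have hcc := continuous_clampRadius R
  set W : BoundedContinuousFunction (ℝ × ℝ) ℝ → ℝ → ℝ → ℝ := fun y μ r =>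
    a μ * Real.exp (L * a μ * clampRadius R r) * y (μ, clampRadius R r) with hW
  have hWc : ∀ y, Continuous (Function.uncurry (W y)) := by
    intro y
    have h1 : Continuous fun z : ℝ × ℝ => clampRadius R z.2 := hcc.comp continuous_snd
    have h2 : Continuous fun z : ℝ × ℝ => a z.1 := hac.comp continuous_fst
    exact (h2.mul (Real.continuous_exp.comp ((continuous_const.mul h2).mul h1))).mul
      (y.continuous.comp (continuous_fst.prodMk h1))
  have hWμ : ∀ y μ, Continuous (W y μ) := fun y μ =>
    (hWc y).comp (continuous_const.prodMk continuous_id)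
  set q : ℝ := K / (K + 1) + 1 / (2 * (K + 1)) with hq
  have hq1 : q < 1 := by
    rw [hq, div_add_div _ _ (by positivity) (by positivity), div_lt_one (by positivity)]
    nlinarith [(Nat.cast_nonneg K : (0 : ℝ) ≤ K)]
  have hq0 : 0 ≤ q := by positivity
  have hgμ : ∀ μ, Continuous fun z : ℝ × ℝ × ℝ × ℝ => g μ z.1 z.2.1 z.2.2.1 z.2.2.2 :=
    fun μ => hg.comp (continuous_const.prodMk continuous_id)
  have main : ∀ (w₁ w₂ : ℝ → ℝ) (μ D r : ℝ), 0 ≤ D → Continuous w₁ → Continuous w₂ →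
      r ∈ Icc 0 R →
      (∀ s ∈ Icc 0 R, |w₁ s - w₂ s| ≤ a μ * D * Real.exp (L * a μ * s)) →
      |radAvg K (g μ) w₁ r - radAvg K (g μ) w₂ r| ≤
        a μ * Real.exp (L * a μ * r) * (q * D) := by
    intro w₁ w₂ μ D r hD h₁ h₂ hr h
    have hω : 0 < L * a μ := mul_pos hLpos (ha0 μ)
    have := abs_radAvg_sub_le hB (mul_nonneg hB (ha0 μ).le) hω (mul_nonneg (ha0 μ).le hD)
      (hgμ μ) (hlip μ) h₁ h₂ h hr
    refine this.trans ?_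
    have e : K / (K + 1) + B / (L * a μ) + B * a μ * R / (L * a μ) ≤ q := by
      have e1 : B / (L * a μ) ≤ B / L := by
        gcongr
        exact le_mul_of_one_le_right hLpos.le (ha1 μ)
      have e2 : B * a μ * R / (L * a μ) = B * R / L := by
        have := (ha0 μ).ne'
        field_simp
      have e3 : B / L + B * R / L ≤ 1 / (2 * (K + 1)) := by
        rw [← add_div, div_le_div_iff₀ hLpos (by positivity), hL]
        nlinarith [(Nat.cast_nonneg K : (0 : ℝ) ≤ K)]
      rw [hq, e2]; linarith
    calc _ ≤ a μ * D * Real.exp (L * a μ * r) * q := by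
          have := ha0 μ
          gcongr
      _ = _ := by ring
  have hWdiff : ∀ y₁ y₂ : BoundedContinuousFunction (ℝ × ℝ) ℝ, ∀ μ, ∀ s ∈ Icc 0 R,
      |W y₁ μ s - W y₂ μ s| ≤ a μ * dist y₁ y₂ * Real.exp (L * a μ * s) := by
    intro y₁ y₂ μ s hs
    simp only [hW, clampRadius_of_mem hs]
    rw [← mul_sub, abs_mul, abs_of_nonneg (by have := ha0 μ; positivity)]
    have := BoundedContinuousFunction.dist_coe_le_dist (f := y₁) (g := y₂) (μ, s)
    rw [Real.dist_eq] at this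
    have := ha0 μ
    calc _ ≤ a μ * Real.exp (L * a μ * s) * dist y₁ y₂ := by gcongr
      _ = _ := by ring
  set T₀ : BoundedContinuousFunction (ℝ × ℝ) ℝ → ℝ × ℝ → ℝ := fun y x =>
    radAvg K (g x.1) (W y x.1) (clampRadius R x.2) /
      (a x.1 * Real.exp (L * a x.1 * clampRadius R x.2)) with hT₀
  have hdiff : ∀ y₁ y₂ x, |T₀ y₁ x - T₀ y₂ x| ≤ q * dist y₁ y₂ := by
    intro y₁ y₂ x
    have hpos : 0 < a x.1 * Real.exp (L * a x.1 * clampRadius R x.2) :=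
      mul_pos (ha0 _) (Real.exp_pos _)
    simp only [hT₀]
    rw [← sub_div, abs_div, abs_of_pos hpos, div_le_iff₀ hpos]
    refine (main _ _ x.1 _ _ dist_nonneg (hWμ y₁ x.1) (hWμ y₂ x.1) (clampRadius_mem hR _)
      (hWdiff y₁ y₂ x.1)).trans_eq (by ring)
  have hT0 : ∀ x, |T₀ 0 x| ≤ B := by
    intro x
    have hpos : 0 < a x.1 * Real.exp (L * a x.1 * clampRadius R x.2) :=
      mul_pos (ha0 _) (Real.exp_pos _)
    have h1 : 1 ≤ Real.exp (L * a x.1 * clampRadius R x.2) :=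
      Real.one_le_exp (mul_nonneg (mul_pos hLpos (ha0 _)).le (clampRadius_mem hR _).1)
    simp only [hT₀]
    rw [abs_div, abs_of_pos hpos, div_le_iff₀ hpos]
    have hW0 : W 0 x.1 = fun _ => 0 := by ext r; simp [hW]
    rw [hW0]
    have : |radAvg K (g x.1) (fun _ => 0) (clampRadius R x.2)| ≤ B * a x.1 := by
      unfold radAvg
      rw [← Real.norm_eq_abs]
      refine (intervalIntegral.norm_integral_le_of_norm_le_const (C := B * a x.1) ?_).trans_eq
        (by simp)
      intro t ht
      rw [uIoc_of_le zero_le_one] at ht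
      have := hlip x.1 0 0 1 0 0 0 (clampRadius R x.2 * t)
      rw [hzero] at this
      simp only [sub_self, abs_zero, mul_zero, zero_add, sub_zero, abs_one, mul_one] at this
      simp only [radPrim, mul_zero, intervalIntegral.integral_zero, add_zero, norm_mul,
        norm_pow, Real.norm_eq_abs, abs_of_pos ht.1]
      calc _ ≤ 1 * |g x.1 0 0 1 (clampRadius R x.2 * t)| := by
            gcongr; exact pow_le_one₀ ht.1.le ht.2
        _ ≤ _ := by rw [one_mul]; exact this
    refine this.trans ?_
    have h2 : 0 ≤ B * a x.1 := mul_nonneg hB (ha0 _).le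
    nlinarith
  have hT₀c : ∀ y, Continuous (T₀ y) := by
    intro y
    have h1 : Continuous fun z : ℝ × ℝ => clampRadius R z.2 := hcc.comp continuous_snd
    have h2 : Continuous fun z : ℝ × ℝ => a z.1 := hac.comp continuous_fst
    refine Continuous.div ((continuous_radAvg hg (hWc y)).comp (continuous_fst.prodMk h1))
      (h2.mul (Real.continuous_exp.comp ((continuous_const.mul h2).mul h1))) ?_
    intro x
    exact (mul_pos (ha0 _) (Real.exp_pos _)).ne'
  have hT₀b : ∀ y x, ‖T₀ y x‖ ≤ q * dist y 0 + B := by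
    intro y x
    have h1 := hdiff y 0 x
    have h2 := hT0 x
    rw [Real.norm_eq_abs]
    have h3 := abs_add_le (T₀ y x - T₀ 0 x) (T₀ 0 x)
    rw [sub_add_cancel] at h3
    linarith
  set T : BoundedContinuousFunction (ℝ × ℝ) ℝ → BoundedContinuousFunction (ℝ × ℝ) ℝ := fun y =>
    BoundedContinuousFunction.ofNormedAddCommGroup (T₀ y) (hT₀c y) _ (hT₀b y) with hT
  have hcontr : ContractingWith ⟨q, hq0⟩ T := by
    refine ⟨by exact_mod_cast hq1, LipschitzWith.of_dist_le_mul fun y₁ y₂ => ?_⟩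
    refine (BoundedContinuousFunction.dist_le (mul_nonneg hq0 dist_nonneg)).2 fun x => ?_
    rw [Real.dist_eq]
    exact hdiff y₁ y₂ x
  set y := hcontr.fixedPoint with hy
  have hfix : T y = y := hcontr.fixedPoint_isFixedPt
  refine ⟨W y, hWc y, fun μ r hr => ?_⟩
  have h1 : y (μ, r) = T₀ y (μ, r) := by
    conv_lhs => rw [← hfix]
    rfl
  have hpos : 0 < a μ * Real.exp (L * a μ * r) := mul_pos (ha0 _) (Real.exp_pos _)
  have h2 : W y μ r = a μ * Real.exp (L * a μ * r) * y (μ, r) := by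
    simp only [hW, clampRadius_of_mem hr]
  rw [h2, h1]
  simp only [hT₀, clampRadius_of_mem hr]
  have := (ha0 μ).ne'
  field_simp

/-! ### Solving the operator for the second derivative -/

/-- A radial operator, defined for all radii, that is positively homogeneous, uniformly elliptic
in the Hessian variables and Lipschitz in the lower order ones. -/
structure IsRadialElliptic (lam Lam Γ gam del : ℝ) (F : ℝ → ℝ → ℝ → ℝ → ℝ → ℝ) : Prop where
  lam_pos : 0 < lam
  lam_le : lam ≤ Lam
  lip_nonneg : 0 ≤ Γ
  gam_nonneg : 0 ≤ gam
  del_nonneg : 0 ≤ del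
  cont : Continuous fun z : ℝ × ℝ × ℝ × ℝ × ℝ => F z.1 z.2.1 z.2.2.1 z.2.2.2.1 z.2.2.2.2
  homog : ∀ s, 0 ≤ s → ∀ m l p u r, F (s * m) (s * l) (s * p) (s * u) r = s * F m l p u r
  lower : ∀ m m' l p u r, m' ≤ m → lam * (m - m') ≤ F m l p u r - F m' l p u r
  upper : ∀ m m' l p u r, m' ≤ m → F m l p u r - F m' l p u r ≤ Lam * (m - m')
  mono : ∀ m l l' p u r, l' ≤ l → F m l' p u r ≤ F m l p u r
  lip : ∀ m l p u l' p' u' r,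
    |F m l p u r - F m l' p' u' r| ≤ Γ * |l - l'| + gam * |p - p'| + del * |u - u'|

/-- The second derivative `m` determined by `F(m,l,p,u,r) = -μ u`. -/
noncomputable def radHess (F : ℝ → ℝ → ℝ → ℝ → ℝ → ℝ) (μ l p u r : ℝ) : ℝ :=
  Classical.epsilon fun m => F m l p u r = -μ * u

namespace IsRadialElliptic

variable {lam Lam Γ gam del : ℝ} {F : ℝ → ℝ → ℝ → ℝ → ℝ → ℝ}

theorem lower_abs (hF : IsRadialElliptic lam Lam Γ gam del F) (m m' l p u r : ℝ) :
    lam * |m - m'| ≤ |F m l p u r - F m' l p u r| := by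
  rcases le_total m' m with h | h
  · rw [abs_of_nonneg (sub_nonneg.2 h)]
    exact (hF.lower _ _ l p u r h).trans (le_abs_self _)
  · rw [abs_sub_comm, abs_of_nonneg (sub_nonneg.2 h), abs_sub_comm (F m l p u r)]
    exact (hF.lower _ _ l p u r h).trans (le_abs_self _)

theorem strictMono (hF : IsRadialElliptic lam Lam Γ gam del F) (l p u r : ℝ) :
    StrictMono fun m => F m l p u r := by
  intro m' m h
  have h1 := hF.lower _ _ l p u r h.le
  have h2 := mul_pos hF.lam_pos (sub_pos.2 h)
  show F m' l p u r < F m l p u r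
  linarith

theorem radHess_spec (hF : IsRadialElliptic lam Lam Γ gam del F) (μ l p u r : ℝ) :
    F (radHess F μ l p u r) l p u r = -μ * u := by
  refine Classical.epsilon_spec (p := fun m => F m l p u r = -μ * u) ?_
  have hc : Continuous fun m => F m l p u r :=
    hF.cont.comp
      (continuous_id.prodMk (continuous_const (y := ((l, p, u, r) : ℝ × ℝ × ℝ × ℝ))))
  set e := |(-μ * u) - F 0 l p u r| / lam with he
  have he0 : 0 ≤ e := div_nonneg (abs_nonneg _) hF.lam_pos.le
  have hmul : lam * e = |(-μ * u) - F 0 l p u r| := by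
    rw [he]; exact mul_div_cancel₀ _ hF.lam_pos.ne'
  apply mem_range_of_exists_le_of_exists_ge hc
  · refine ⟨-e, ?_⟩
    have := hF.lower 0 (-e) l p u r (by linarith)
    have h2 := neg_abs_le ((-μ * u) - F 0 l p u r)
    simp only [zero_sub, neg_neg] at this
    linarith
  · refine ⟨e, ?_⟩
    have := hF.lower e 0 l p u r he0
    have h2 := le_abs_self ((-μ * u) - F 0 l p u r)
    simp only [sub_zero] at this
    linarith

theorem eq_radHess (hF : IsRadialElliptic lam Lam Γ gam del F) {m μ l p u r : ℝ}
    (h : F m l p u r = -μ * u) : m = radHess F μ l p u r :=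
  (hF.strictMono l p u r).injective (h.trans (hF.radHess_spec μ l p u r).symm)

theorem apply_zero (hF : IsRadialElliptic lam Lam Γ gam del F) (r : ℝ) : F 0 0 0 0 r = 0 := by
  simpa using hF.homog 0 le_rfl 0 0 0 0 r

theorem radHess_zero (hF : IsRadialElliptic lam Lam Γ gam del F) (μ r : ℝ) :
    radHess F μ 0 0 0 r = 0 :=
  (hF.eq_radHess (by simp [hF.apply_zero])).symm

theorem radHess_smul (hF : IsRadialElliptic lam Lam Γ gam del F) {s : ℝ} (hs : 0 ≤ s)
    (μ l p u r : ℝ) : radHess F μ (s * l) (s * p) (s * u) r = s * radHess F μ l p u r := by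
  refine (hF.eq_radHess ?_).symm
  rw [hF.homog s hs, hF.radHess_spec]
  ring

theorem radHess_lip (hF : IsRadialElliptic lam Lam Γ gam del F) (μ l p u l' p' u' r : ℝ) :
    lam * |radHess F μ l p u r - radHess F μ l' p' u' r| ≤
      Γ * |l - l'| + gam * |p - p'| + (del + |μ|) * |u - u'| := by
  set m := radHess F μ l p u r
  set m' := radHess F μ l' p' u' r
  refine (hF.lower_abs m m' l p u r).trans ?_
  have e : F m l p u r - F m' l p u r = (F m' l' p' u' r - F m' l p u r) + -(μ * (u - u')) := by
    rw [hF.radHess_spec μ l p u r, hF.radHess_spec μ l' p' u' r]; ring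
  have h1 := hF.lip m' l' p' u' l p u r
  rw [abs_sub_comm l', abs_sub_comm p', abs_sub_comm u'] at h1
  rw [e]
  refine (abs_add_le _ _).trans ?_
  rw [abs_neg, abs_mul]
  linarith

theorem radHess_anti (hF : IsRadialElliptic lam Lam Γ gam del F) {l l' : ℝ} (h : l' ≤ l)
    (μ p u r : ℝ) : radHess F μ l p u r ≤ radHess F μ l' p u r := by
  rw [← (hF.strictMono l' p u r).le_iff_le]
  show F (radHess F μ l p u r) l' p u r ≤ F (radHess F μ l' p u r) l' p u r
  rw [hF.radHess_spec, ← hF.radHess_spec μ l p u r]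
  exact hF.mono _ _ _ _ _ _ h

theorem mul_radHess_anti (hF : IsRadialElliptic lam Lam Γ gam del F) {μ₁ μ₂ : ℝ} (h : μ₁ ≤ μ₂)
    (l p u r : ℝ) : u * radHess F μ₂ l p u r ≤ u * radHess F μ₁ l p u r := by
  have hm : ∀ {a b}, F a l p u r ≤ F b l p u r ↔ a ≤ b := (hF.strictMono l p u r).le_iff_le
  have e₁ := hF.radHess_spec μ₁ l p u r
  have e₂ := hF.radHess_spec μ₂ l p u r
  rcases le_total 0 u with hu | hu
  · refine mul_le_mul_of_nonneg_left (hm.1 ?_) hu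
    simp only [e₁, e₂]
    nlinarith
  · refine mul_le_mul_of_nonpos_left (hm.1 ?_) hu
    simp only [e₁, e₂]
    nlinarith

theorem continuous_radHess (hF : IsRadialElliptic lam Lam Γ gam del F) :
    Continuous fun z : ℝ × ℝ × ℝ × ℝ × ℝ =>
      radHess F z.1 z.2.1 z.2.2.1 z.2.2.2.1 z.2.2.2.2 := by
  rw [continuous_iff_continuousAt]
  rintro ⟨μ, l, p, u, r⟩
  set m := radHess F μ l p u r with hm
  have hc : Continuous fun z : ℝ × ℝ × ℝ × ℝ × ℝ =>
      |-z.1 * z.2.2.2.1 - F m z.2.1 z.2.2.1 z.2.2.2.1 z.2.2.2.2| / lam := by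
    have h1 : Continuous fun z : ℝ × ℝ × ℝ × ℝ × ℝ =>
        F m z.2.1 z.2.2.1 z.2.2.2.1 z.2.2.2.2 :=
      hF.cont.comp (continuous_const.prodMk continuous_snd)
    exact (((continuous_fst.neg.mul continuous_snd.snd.snd.fst).sub h1).abs).div_const lam
  have h0 : Filter.Tendsto (fun z : ℝ × ℝ × ℝ × ℝ × ℝ =>
      |-z.1 * z.2.2.2.1 - F m z.2.1 z.2.2.1 z.2.2.2.1 z.2.2.2.2| / lam)
      (nhds (μ, l, p, u, r)) (nhds 0) := by
    have := hc.tendsto (μ, l, p, u, r)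
    simp only [hm, hF.radHess_spec μ l p u r, sub_self, abs_zero, zero_div] at this
    exact this
  refine tendsto_iff_dist_tendsto_zero.2 (squeeze_zero (fun _ => dist_nonneg) (fun z => ?_) h0)
  rw [le_div_iff₀ hF.lam_pos, mul_comm, Real.dist_eq]
  refine (hF.lower_abs _ _ z.2.1 z.2.2.1 z.2.2.2.1 z.2.2.2.2).trans_eq ?_
  rw [hF.radHess_spec]

/-- Secant slope of `F` in the second derivative between the state zero and a given state. -/
theorem exists_slope (hF : IsRadialElliptic lam Lam Γ gam del F) (m r : ℝ) :
    ∃ k, lam ≤ k ∧ k ≤ Lam ∧ F m 0 0 0 r = k * m := by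
  have h0 := hF.apply_zero r
  rcases lt_trichotomy m 0 with h | h | h
  · refine ⟨F m 0 0 0 r / m, ?_, ?_, (div_mul_cancel₀ _ h.ne).symm⟩
    · rw [le_div_iff_of_neg h]; have := hF.lower 0 m 0 0 0 r h.le; linarith
    · rw [div_le_iff_of_neg h]; have := hF.upper 0 m 0 0 0 r h.le; linarith
  · exact ⟨lam, le_rfl, hF.lam_le, by simp [h, h0]⟩
  · refine ⟨F m 0 0 0 r / m, ?_, ?_, (div_mul_cancel₀ _ h.ne').symm⟩
    · rw [le_div_iff₀ h]; have := hF.lower m 0 0 0 0 r h.le; linarith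
    · rw [div_le_iff₀ h]; have := hF.upper m 0 0 0 0 r h.le; linarith

theorem mul_radHess_le (hF : IsRadialElliptic lam Lam Γ gam del F) {μ : ℝ} (hμ : del ≤ μ)
    (u r : ℝ) : u * radHess F μ 0 0 u r ≤ -((μ - del) / Lam * u ^ 2) := by
  have hLam : 0 < Lam := hF.lam_pos.trans_le hF.lam_le
  obtain ⟨k, hk1, hk2, hk⟩ := hF.exists_slope (radHess F μ 0 0 u r) r
  have h1 := hF.lip (radHess F μ 0 0 u r) 0 0 0 0 0 u r
  have h2 := hF.radHess_spec μ 0 0 u r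
  set m := radHess F μ 0 0 u r
  rw [hk, h2] at h1
  simp only [sub_self, abs_zero, mul_zero, zero_add, zero_sub, abs_neg] at h1
  have hk0 : 0 < k := hF.lam_pos.trans_le hk1
  have h3 : u * (k * m - -μ * u) ≤ del * u ^ 2 := by
    calc _ ≤ |u * (k * m - -μ * u)| := le_abs_self _
      _ = |u| * |k * m - -μ * u| := abs_mul _ _
      _ ≤ |u| * (del * |u|) := by gcongr
      _ = del * (|u| * |u|) := by ring
      _ = del * u ^ 2 := by rw [abs_mul_abs_self]; ring
  have h4 : k * (u * m) ≤ -((μ - del) * u ^ 2) := by linarith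
  have h5 : 0 ≤ (μ - del) * u ^ 2 := mul_nonneg (sub_nonneg.2 hμ) (sq_nonneg u)
  have h6 : u * m ≤ 0 := by
    by_contra h
    have := mul_pos hk0 (not_le.1 h)
    linarith
  have h7 : Lam * (u * m) ≤ k * (u * m) := mul_le_mul_of_nonpos_right hk2 h6
  rw [div_mul_eq_mul_div, ← neg_div, le_div_iff₀ hLam]
  linarith

theorem le_radHess (hF : IsRadialElliptic lam Lam Γ gam del F) {M s l r : ℝ}
    (hM : gam + del ≤ M) (hs : 0 ≤ s) (hl : l ≤ 0) :
    (M - gam - del) / Lam * s ≤ radHess F (-M) l (-s) s r := by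
  have hLam : 0 < Lam := hF.lam_pos.trans_le hF.lam_le
  refine le_trans ?_ (hF.radHess_anti hl (-M) (-s) s r)
  obtain ⟨k, hk1, hk2, hk⟩ := hF.exists_slope (radHess F (-M) 0 (-s) s r) r
  have h1 := hF.lip (radHess F (-M) 0 (-s) s r) 0 0 0 0 (-s) s r
  have h2 := hF.radHess_spec (-M) 0 (-s) s r
  set m := radHess F (-M) 0 (-s) s r
  rw [hk, h2] at h1
  simp only [sub_self, abs_zero, mul_zero, zero_add, zero_sub, abs_neg, neg_neg,
    abs_of_nonneg hs] at h1
  have hk0 : 0 < k := hF.lam_pos.trans_le hk1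
  have h3 := (abs_le.1 h1).1
  have h4 : (M - gam - del) * s ≤ k * m := by linarith
  have h5 : 0 ≤ (M - gam - del) * s := mul_nonneg (by linarith) hs
  have h6 : 0 ≤ m := by
    by_contra h
    have := mul_neg_of_pos_of_neg hk0 (not_le.1 h)
    linarith
  rw [div_mul_eq_mul_div, div_le_iff₀ hLam]
  nlinarith

end IsRadialElliptic

/-! ### Differential inequalities on an interval -/

theorem pos_of_neg_mul_le_deriv {D D' : ℝ → ℝ} {a b L : ℝ} (hc : ContinuousOn D (Icc a b))
    (hd : ∀ x ∈ Ioo a b, HasDerivAt D (D' x) x) (ha : 0 < D a)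
    (hL : ∀ x ∈ Ioo a b, 0 < D x → -L * D x ≤ D' x) : ∀ x ∈ Icc a b, 0 < D x := by
  by_contra! hcon
  set S : Set ℝ := Icc a b ∩ D ⁻¹' Iic 0 with hS
  have hSc : IsCompact S :=
    isCompact_Icc.of_isClosed_subset (hc.preimage_isClosed_of_isClosed isClosed_Icc isClosed_Iic)
      inter_subset_left
  obtain ⟨x, hx, hDx⟩ := hcon
  obtain ⟨c, hcS, hmin⟩ := hSc.exists_isLeast ⟨x, hx, hDx⟩
  have hpos : ∀ y ∈ Ico a c, 0 < D y := by
    intro y hy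
    by_contra h
    exact absurd (hmin ⟨⟨hy.1, hy.2.le.trans hcS.1.2⟩, not_lt.1 h⟩) (not_le.2 hy.2)
  have hsub : Icc a c ⊆ Icc a b := Icc_subset_Icc_right hcS.1.2
  have hmono : MonotoneOn (fun y => D y * Real.exp (L * y)) (Icc a c) := by
    have hder : ∀ y ∈ Ioo a c, HasDerivAt (fun y => D y * Real.exp (L * y))
        (D' y * Real.exp (L * y) + D y * (Real.exp (L * y) * L)) y := by
      intro y hy
      have h2 : HasDerivAt (fun y => Real.exp (L * y)) (Real.exp (L * y) * L) y := by
        simpa using ((hasDerivAt_id y).const_mul L).exp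
      exact (hd y ⟨hy.1, hy.2.trans_le hcS.1.2⟩).mul h2
    apply monotoneOn_of_deriv_nonneg (convex_Icc a c)
    · exact (hc.mono hsub).mul (by fun_prop)
    · rw [interior_Icc]
      exact fun y hy => (hder y hy).differentiableAt.differentiableWithinAt
    · rw [interior_Icc]
      intro y hy
      rw [(hder y hy).deriv]
      have h1 := hL y ⟨hy.1, hy.2.trans_le hcS.1.2⟩ (hpos y ⟨hy.1.le, hy.2⟩)
      nlinarith [Real.exp_pos (L * y)]
  have hac := hcS.1.1
  have h1 := hmono (left_mem_Icc.2 hac) (right_mem_Icc.2 hac) hac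
  have h2 : 0 < D a * Real.exp (L * a) := mul_pos ha (Real.exp_pos _)
  have h3 : D c * Real.exp (L * c) ≤ 0 :=
    mul_nonpos_of_nonpos_of_nonneg hcS.2 (Real.exp_pos _).le
  simp only at h1
  linarith

theorem eq_zero_of_deriv_le_mul {E E' : ℝ → ℝ} {a b C : ℝ} (hc : ContinuousOn E (Icc a b))
    (hd : ∀ x ∈ Ioo a b, HasDerivAt E (E' x) x) (ha : E a = 0)
    (hnonneg : ∀ x ∈ Icc a b, 0 ≤ E x) (hC : ∀ x ∈ Ioo a b, E' x ≤ C * E x) :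
    ∀ x ∈ Icc a b, E x = 0 := by
  have hanti : AntitoneOn (fun y => E y * Real.exp (-C * y)) (Icc a b) := by
    have hder : ∀ y ∈ Ioo a b, HasDerivAt (fun y => E y * Real.exp (-C * y))
        (E' y * Real.exp (-C * y) + E y * (Real.exp (-C * y) * -C)) y := by
      intro y hy
      have h2 : HasDerivAt (fun y => Real.exp (-C * y)) (Real.exp (-C * y) * -C) y := by
        simpa using ((hasDerivAt_id y).const_mul (-C)).exp
      exact (hd y hy).mul h2
    apply antitoneOn_of_deriv_nonpos (convex_Icc a b)
    · exact hc.mul (by fun_prop)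
    · rw [interior_Icc]
      exact fun y hy => (hder y hy).differentiableAt.differentiableWithinAt
    · rw [interior_Icc]
      intro y hy
      rw [(hder y hy).deriv]
      nlinarith [Real.exp_pos (-C * y), hC y hy]
  intro x hx
  have h1 := hanti (left_mem_Icc.2 (hx.1.trans hx.2)) hx hx.1
  simp only [ha, zero_mul] at h1
  exact le_antisymm (nonpos_of_mul_nonpos_left h1 (Real.exp_pos _)) (hnonneg x hx)

theorem pos_of_upward_crossing {f f' : ℝ → ℝ} {a b : ℝ}
    (hd : ∀ x ∈ Icc a b, HasDerivAt f (f' x) x) (ha : 0 ≤ f a)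
    (hup : ∀ x ∈ Icc a b, f x = 0 → 0 < f' x) : ∀ x ∈ Ioc a b, 0 < f x := by
  have hnonneg : ∀ x ∈ Icc a b, 0 ≤ f x := by
    have h := image_le_of_deriv_right_lt_deriv_boundary (f := fun x => -f x)
      (f' := fun x => -f' x) (a := a) (b := b) (B := fun _ => 0) (B' := fun _ => 0)
      (fun x hx => (hd x hx).continuousAt.neg.continuousWithinAt)
      (fun x hx => (hd x (Ico_subset_Icc_self hx)).neg.hasDerivWithinAt)
      (by simpa using ha) (fun x => hasDerivAt_const x 0)
      (fun x hx h0 => by simpa using hup x (Ico_subset_Icc_self hx) (by simpa using h0))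
    exact fun x hx => by simpa using h hx
  intro x hx
  have hx' : x ∈ Icc a b := Ioc_subset_Icc_self hx
  refine lt_of_le_of_ne (hnonneg x hx') fun h0 => ?_
  have hpos := hup x hx' h0.symm
  have hslope := (hasDerivAt_iff_tendsto_slope_left_right.1 (hd x hx')).1
  have h1 : ∀ᶠ y in nhdsWithin x (Iio x), 0 < slope f x y := hslope.eventually (lt_mem_nhds hpos)
  have h2 : ∀ᶠ y in nhdsWithin x (Iio x), y ∈ Ioo a x := Ioo_mem_nhdsLT hx.1
  obtain ⟨y, hy1, hy2⟩ := (h1.and h2).exists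
  rw [slope_def_field, ← h0, sub_zero] at hy1
  have h3 := hnonneg y ⟨hy2.1.le, hy2.2.le.trans hx.2⟩
  have h4 : f y / (y - x) ≤ 0 := div_nonpos_of_nonneg_of_nonpos h3 (by linarith [hy2.2])
  linarith

/-! ### The solution family of the initial value problem -/

/-- `u μ` solves the radial equation with `u(0) = 1`, `u'(0) = 0`, and `w μ r = u' / r`. -/
structure IsRadialFlow (F : ℝ → ℝ → ℝ → ℝ → ℝ → ℝ) (R : ℝ) (w u : ℝ → ℝ → ℝ) : Prop where
  cont_w : Continuous (Function.uncurry w)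
  cont_u : Continuous (Function.uncurry u)
  init : ∀ μ, u μ 0 = 1
  deriv_u : ∀ μ r, HasDerivAt (u μ) (r * w μ r) r
  w_zero : ∀ μ, w μ 0 = radHess F μ (w μ 0) 0 1 0
  deriv_p : ∀ μ, ∀ r ∈ Ioo 0 R,
    HasDerivAt (fun r => r * w μ r) (radHess F μ (w μ r) (r * w μ r) (u μ r) r) r

section RadialSpectrum

variable {lam Lam Γ gam del R : ℝ} {F : ℝ → ℝ → ℝ → ℝ → ℝ → ℝ} {w u : ℝ → ℝ → ℝ}

theorem hasDerivAt_of_eq_radAvg {k : ℕ} {g : ℝ → ℝ → ℝ → ℝ → ℝ}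
    (hg : Continuous fun z : ℝ × ℝ × ℝ × ℝ => g z.1 z.2.1 z.2.2.1 z.2.2.2)
    {v : ℝ → ℝ} (hv : Continuous v) (hfix : ∀ r ∈ Icc 0 R, v r = radAvg (k + 1) g v r)
    {r : ℝ} (hr : r ∈ Ioo 0 R) :
    HasDerivAt (fun r => r * v r) (g (v r) (r * v r) (radPrim v r) r - (k + 1) * v r) r := by
  have hp : Continuous (radPrim v) :=
    (continuous_radPrim (w := fun _ => v) (hv.comp continuous_snd)).comp
      (continuous_const.prodMk continuous_id : Continuous fun r : ℝ => ((0 : ℝ), r))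
  set H : ℝ → ℝ := fun s => s ^ (k + 1) * g (v s) (s * v s) (radPrim v s) s with hH
  have hHc : Continuous H :=
    (continuous_id.pow _).mul
      (hg.comp (hv.prodMk ((continuous_id.mul hv).prodMk (hp.prodMk continuous_id))))
  have hI : ∀ s ∈ Ioo 0 R, ∫ τ in (0 : ℝ)..s, H τ = s ^ (k + 2) * v s := by
    intro s hs
    have h1 := intervalIntegral.integral_comp_mul_left (a := 0) (b := 1) H hs.1.ne'
    have h2 : ∫ t in (0 : ℝ)..1, H (s * t) = s ^ (k + 1) * v s := by
      rw [hfix s ⟨hs.1.le, hs.2.le⟩]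
      unfold radAvg
      rw [← intervalIntegral.integral_const_mul]
      refine intervalIntegral.integral_congr fun t _ => ?_
      simp only [hH, mul_pow, mul_assoc]
    rw [h2, mul_zero, mul_one, smul_eq_mul] at h1
    have := hs.1.ne'
    field_simp at h1
    rw [← h1]; ring
  have hev : (fun s => s * v s) =ᶠ[nhds r] fun s => (∫ τ in (0 : ℝ)..s, H τ) / s ^ (k + 1) := by
    filter_upwards [Ioo_mem_nhds hr.1 hr.2] with s hs
    rw [hI s hs]
    have := hs.1.ne'
    field_simp
    ring
  have hd := ((hHc.integral_hasStrictDerivAt 0 r).hasDerivAt.div (hasDerivAt_pow (k + 1) r)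
    (pow_ne_zero _ hr.1.ne')).congr_of_eventuallyEq hev
  refine hd.congr_deriv ?_
  rw [hI r hr]
  simp only [hH]
  have := hr.1.ne'
  push_cast
  field_simp
  ring

theorem IsRadialElliptic.exists_flow (hF : IsRadialElliptic lam Lam Γ gam del F) (hR : 0 ≤ R) :
    ∃ w u : ℝ → ℝ → ℝ, IsRadialFlow F R w u := by
  obtain ⟨k, hk⟩ := exists_nat_ge (Γ / lam)
  have hlam := hF.lam_pos
  have hkK : Γ ≤ lam * (k + 1) := by
    rw [div_le_iff₀ hlam] at hk; nlinarith
  set B : ℝ := (gam + del + 1) / lam with hB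
  have hB0 : 0 ≤ B := by have := hF.gam_nonneg; have := hF.del_nonneg; positivity
  have hBl : lam * B = gam + del + 1 := mul_div_cancel₀ _ hlam.ne'
  set g : ℝ → ℝ → ℝ → ℝ → ℝ → ℝ := fun μ l p u r => radHess F μ l p u r + (k + 1) * l with hg
  have hgc : Continuous fun z : ℝ × ℝ × ℝ × ℝ × ℝ =>
      g z.1 z.2.1 z.2.2.1 z.2.2.2.1 z.2.2.2.2 :=
    hF.continuous_radHess.add (continuous_const.mul continuous_snd.fst)
  have hlip_l : ∀ μ l l' p u r, l' ≤ l →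
      |g μ l p u r - g μ l' p u r| ≤ (k + 1) * |l - l'| := by
    intro μ l l' p u r h
    have h1 := hF.radHess_anti h μ p u r
    have h2 := hF.radHess_lip μ l p u l' p u r
    simp only [sub_self, abs_zero, mul_zero, add_zero, abs_of_nonneg (sub_nonneg.2 h)] at h2
    rw [abs_of_nonpos (sub_nonpos.2 h1)] at h2
    have h3 : -(radHess F μ l p u r - radHess F μ l' p u r) ≤ (k + 1) * (l - l') := by
      refine le_of_mul_le_mul_left (h2.trans ?_) hlam
      nlinarith [mul_le_mul_of_nonneg_right hkK (sub_nonneg.2 h)]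
    rw [abs_of_nonneg (sub_nonneg.2 h), abs_le]
    simp only [hg]
    constructor <;> nlinarith
  have hlip : ∀ μ l p u l' p' u' r, |g μ l p u r - g μ l' p' u' r| ≤
      (k + 1 : ℕ) * |l - l'| + B * |p - p'| + B * (1 + |μ|) * |u - u'| := by
    intro μ l p u l' p' u' r
    have h1 : |g μ l p u r - g μ l' p u r| ≤ (k + 1) * |l - l'| := by
      rcases le_total l' l with h | h
      · exact hlip_l μ l l' p u r h
      · rw [abs_sub_comm, abs_sub_comm l]; exact hlip_l μ l' l p u r h
    have h2 : |g μ l' p u r - g μ l' p' u' r| ≤ B * |p - p'| + B * (1 + |μ|) * |u - u'| := by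
      have h3 := hF.radHess_lip μ l' p u l' p' u' r
      simp only [sub_self, abs_zero, mul_zero, zero_add] at h3
      simp only [hg, add_sub_add_right_eq_sub]
      refine le_of_mul_le_mul_left (h3.trans ?_) hlam
      have e : lam * (B * |p - p'| + B * (1 + |μ|) * |u - u'|) =
          (gam + del + 1) * |p - p'| + (gam + del + 1) * (1 + |μ|) * |u - u'| := by
        rw [← hBl]; ring
      rw [e]
      have := hF.gam_nonneg
      have := hF.del_nonneg
      have e1 : gam * |p - p'| ≤ (gam + del + 1) * |p - p'| := by gcongr; linarith
      have e2 : (del + |μ|) * |u - u'| ≤ (gam + del + 1) * (1 + |μ|) * |u - u'| := by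
        gcongr; nlinarith [abs_nonneg μ]
      linarith
    have h4 := abs_sub_le (g μ l p u r) (g μ l' p u r) (g μ l' p' u' r)
    push_cast
    linarith
  obtain ⟨w, hwc, hw⟩ := exists_radAvg_fixedPoint (k + 1) hR hB0 hgc hlip
    (fun μ r => by simp [hg, hF.radHess_zero])
  have hwμ : ∀ μ, Continuous (w μ) := fun μ => hwc.comp (continuous_const.prodMk continuous_id)
  have hgμ : ∀ μ, Continuous fun z : ℝ × ℝ × ℝ × ℝ => g μ z.1 z.2.1 z.2.2.1 z.2.2.2 :=
    fun μ => hgc.comp (continuous_const.prodMk continuous_id)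
  refine ⟨w, fun μ => radPrim (w μ), hwc, continuous_radPrim hwc, fun μ => by simp [radPrim],
    fun μ r => ?_, fun μ => ?_, fun μ r hr => ?_⟩
  · exact ((continuous_id.mul (hwμ μ)).integral_hasStrictDerivAt 0 r).hasDerivAt.const_add 1
  · have h := hw μ 0 ⟨le_rfl, hR⟩
    have hint : ∫ t in (0 : ℝ)..1, t ^ (k + 1) = 1 / ((k : ℝ) + 1 + 1) := by
      rw [integral_pow]; simp
    have h' : w μ 0 = 1 / ((k : ℝ) + 1 + 1) * g μ (w μ 0) 0 1 0 := by
      rw [← hint, ← intervalIntegral.integral_mul_const]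
      simpa [radAvg, radPrim] using h
    simp only [hg] at h'
    have : ((k : ℝ) + 1 + 1) ≠ 0 := by positivity
    field_simp at h'
    linarith
  · convert hasDerivAt_of_eq_radAvg (hgμ μ) (hwμ μ) (hw μ) hr using 1
    simp only [hg]; ring

/-! ### The Prüfer angle -/

theorem IsRadialElliptic.mul_abs_radHess_le (hF : IsRadialElliptic lam Lam Γ gam del F)
    (μ l p u r : ℝ) :
    lam * |radHess F μ l p u r| ≤ Γ * |l| + gam * |p| + (del + |μ|) * |u| := by
  simpa [hF.radHess_zero] using hF.radHess_lip μ l p u 0 0 0 r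

namespace IsRadialFlow

theorem continuous_w (h : IsRadialFlow F R w u) (μ : ℝ) : Continuous (w μ) :=
  h.cont_w.comp (continuous_const.prodMk continuous_id)

theorem continuous_u (h : IsRadialFlow F R w u) (μ : ℝ) : Continuous (u μ) :=
  h.cont_u.comp (continuous_const.prodMk continuous_id)

theorem energy_pos (h : IsRadialFlow F R w u) (hF : IsRadialElliptic lam Lam Γ gam del F)
    (μ : ℝ) : ∀ r ∈ Icc 0 R, 0 < u μ r ^ 2 + (r * w μ r) ^ 2 := by
  have huc := h.continuous_u μ
  have hlam := hF.lam_pos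
  have hev : ∀ᶠ r in nhds (0 : ℝ), 0 < u μ r :=
    huc.continuousAt.eventually (lt_mem_nhds (by rw [h.init]; exact one_pos))
  obtain ⟨ε, hε, hball⟩ := Metric.eventually_nhds_iff.1 hev
  have hsmall : ∀ r ∈ Ico 0 ε, 0 < u μ r := fun r hr =>
    hball (by rw [Real.dist_eq, sub_zero, abs_of_nonneg hr.1]; exact hr.2)
  intro r hr
  by_cases hrε : r < ε
  · have := hsmall r ⟨hr.1, hrε⟩
    positivity
  set e := ε / 2 with he
  have he0 : 0 < e := by positivity
  set α := (Γ / e + gam) / lam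
  set β := (del + |μ|) / lam
  have hα : 0 ≤ α := by have := hF.lip_nonneg; have := hF.gam_nonneg; positivity
  have hβ : 0 ≤ β := by have := hF.del_nonneg; positivity
  refine pos_of_neg_mul_le_deriv (D := fun r => u μ r ^ 2 + (r * w μ r) ^ 2)
    (D' := fun r => 2 * u μ r * (r * w μ r) +
      2 * (r * w μ r) * radHess F μ (w μ r) (r * w μ r) (u μ r) r)
    (a := e) (b := r) (L := 1 + 2 * α + β) ?_ ?_ ?_ ?_ r (right_mem_Icc.2 (by linarith))
  · have := h.continuous_w μ
    fun_prop
  · intro x hx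
    have h1 := (h.deriv_u μ x).pow 2
    have h2 := (h.deriv_p μ x ⟨he0.trans hx.1, hx.2.trans_le hr.2⟩).pow 2
    refine (h1.add h2).congr_deriv ?_
    simp
  · have := hsmall e ⟨he0.le, by linarith⟩
    positivity
  · intro x hx _
    have hx0 : 0 < x := he0.trans hx.1
    set p := x * w μ x with hp
    set m := radHess F μ (w μ x) p (u μ x) x
    have hm : |m| ≤ α * |p| + β * |u μ x| := by
      refine le_of_mul_le_mul_left ((hF.mul_abs_radHess_le μ (w μ x) p (u μ x) x).trans ?_) hlam
      have hw : |w μ x| ≤ |p| / e := by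
        rw [le_div_iff₀ he0, hp, abs_mul, abs_of_pos hx0, mul_comm]
        exact mul_le_mul_of_nonneg_right hx.1.le (abs_nonneg _)
      have e1 : lam * (α * |p| + β * |u μ x|) =
          Γ * (|p| / e) + gam * |p| + (del + |μ|) * |u μ x| := by
        simp only [α, β]; field_simp
      rw [e1]
      have := hF.lip_nonneg
      gcongr
    have h1 : -(|u μ x| * |p|) ≤ u μ x * p := by rw [← abs_mul]; exact neg_abs_le _
    have h2 : -(|p| * |m|) ≤ p * m := by rw [← abs_mul]; exact neg_abs_le _
    have h3 : |p| * |m| ≤ |p| * (α * |p| + β * |u μ x|) :=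
      mul_le_mul_of_nonneg_left hm (abs_nonneg _)
    have h4 : 2 * (|u μ x| * |p|) ≤ u μ x ^ 2 + p ^ 2 := by
      rw [← sq_abs (u μ x), ← sq_abs p]; nlinarith [sq_nonneg (|u μ x| - |p|)]
    have h5 : |p| * |p| = p ^ 2 := by rw [abs_mul_abs_self]; ring
    have h6 : 0 ≤ α * u μ x ^ 2 := by positivity
    have h7 : β * (2 * (|u μ x| * |p|)) ≤ β * (u μ x ^ 2 + p ^ 2) := by gcongr
    nlinarith

/-- The derivative of the Prüfer angle. -/
noncomputable def angleSpeed (F : ℝ → ℝ → ℝ → ℝ → ℝ → ℝ) (R : ℝ) (w u : ℝ → ℝ → ℝ)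
    (μ r : ℝ) : ℝ :=
  let s := clampRadius R r
  ((s * w μ s) ^ 2 - u μ s * radHess F μ (w μ s) (s * w μ s) (u μ s) s) /
    (u μ s ^ 2 + (s * w μ s) ^ 2)

/-- The Prüfer angle `θ`, with `u = ρ cos θ` and `u' = -ρ sin θ`. -/
noncomputable def angle (F : ℝ → ℝ → ℝ → ℝ → ℝ → ℝ) (R : ℝ) (w u : ℝ → ℝ → ℝ)
    (μ r : ℝ) : ℝ := ∫ s in (0 : ℝ)..r, angleSpeed F R w u μ s

theorem angleSpeed_of_mem {r : ℝ} (hr : r ∈ Icc 0 R) (μ : ℝ) :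
    angleSpeed F R w u μ r =
      ((r * w μ r) ^ 2 - u μ r * radHess F μ (w μ r) (r * w μ r) (u μ r) r) /
        (u μ r ^ 2 + (r * w μ r) ^ 2) := by
  simp only [angleSpeed, clampRadius_of_mem hr]

theorem continuous_angleSpeed (h : IsRadialFlow F R w u)
    (hF : IsRadialElliptic lam Lam Γ gam del F) (hR : 0 ≤ R) :
    Continuous (Function.uncurry (angleSpeed F R w u)) := by
  have hs : Continuous fun z : ℝ × ℝ => clampRadius R z.2 :=
    (continuous_clampRadius R).comp continuous_snd
  have hw : Continuous fun z : ℝ × ℝ => w z.1 (clampRadius R z.2) :=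
    h.cont_w.comp (continuous_fst.prodMk hs)
  have hu : Continuous fun z : ℝ × ℝ => u z.1 (clampRadius R z.2) :=
    h.cont_u.comp (continuous_fst.prodMk hs)
  have hm := hF.continuous_radHess.comp
    (continuous_fst.prodMk (hw.prodMk ((hs.mul hw).prodMk (hu.prodMk hs))))
  exact (((hs.mul hw).pow 2).sub (hu.mul hm)).div ((hu.pow 2).add ((hs.mul hw).pow 2))
    fun z => (h.energy_pos hF z.1 _ (clampRadius_mem hR z.2)).ne'

theorem continuous_angle (h : IsRadialFlow F R w u)
    (hF : IsRadialElliptic lam Lam Γ gam del F) (hR : 0 ≤ R) (r : ℝ) :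
    Continuous fun μ => angle F R w u μ r :=
  intervalIntegral.continuous_parametric_intervalIntegral_of_continuous'
    (h.continuous_angleSpeed hF hR) 0 r

theorem hasDerivAt_angle (h : IsRadialFlow F R w u)
    (hF : IsRadialElliptic lam Lam Γ gam del F) (hR : 0 ≤ R) (μ r : ℝ) :
    HasDerivAt (angle F R w u μ) (angleSpeed F R w u μ r) r :=
  (((h.continuous_angleSpeed hF hR).comp
    (continuous_const.prodMk continuous_id : Continuous fun r : ℝ => (μ, r)))
      |>.integral_hasStrictDerivAt 0 r).hasDerivAt

theorem angle_zero (μ : ℝ) : angle F R w u μ 0 = 0 := by simp [angle]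

theorem exists_polar (h : IsRadialFlow F R w u) (hF : IsRadialElliptic lam Lam Γ gam del F)
    (μ : ℝ) {r : ℝ} (hr : r ∈ Icc 0 R) :
    ∃ a, 0 < a ∧ u μ r = a * Real.cos (angle F R w u μ r) ∧
      r * w μ r = -a * Real.sin (angle F R w u μ r) := by
  have hR : 0 ≤ R := hr.1.trans hr.2
  set θ := angle F R w u μ with hθ
  have hθd := h.hasDerivAt_angle hF hR μ
  have hθc : Continuous θ := continuous_iff_continuousAt.2 fun r => (hθd r).continuousAt
  have hwc := h.continuous_w μ
  have huc := h.continuous_u μ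
  set A : ℝ → ℝ := fun r => u μ r * Real.cos (θ r) - r * w μ r * Real.sin (θ r) with hA
  set b : ℝ → ℝ := fun r => u μ r * Real.sin (θ r) + r * w μ r * Real.cos (θ r) with hb
  set E : ℝ → ℝ := fun r => u μ r ^ 2 + (r * w μ r) ^ 2 with hE
  have hEpos : ∀ x ∈ Icc 0 R, 0 < E x := h.energy_pos hF μ
  have hb0 : ∀ x ∈ Icc 0 R, b x = 0 := by
    have hq := eq_zero_of_deriv_le_mul (E := fun x => b x ^ 2 / E x) (E' := fun _ => 0) (a := 0)
      (b := R) (C := 0) ?_ ?_ ?_ ?_ ?_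
    · intro x hx
      simpa [(hEpos x hx).ne'] using hq x hx
    · refine ContinuousOn.div ?_ ?_ fun x hx => (hEpos x hx).ne'
      · simp only [hb]; fun_prop
      · simp only [hE]; fun_prop
    · intro x hx
      have hx' : x ∈ Icc 0 R := Ioo_subset_Icc_self hx
      have hx0 := (hEpos x hx').ne'
      have du := h.deriv_u μ x
      have dp := h.deriv_p μ x hx
      have dθ := hθd x
      have hφ : angleSpeed F R w u μ x * E x =
          (x * w μ x) ^ 2 - u μ x * radHess F μ (w μ x) (x * w μ x) (u μ x) x := by
        rw [angleSpeed_of_mem hx', hE, div_mul_cancel₀ _ hx0]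
      have db := (du.mul dθ.sin).add (dp.mul dθ.cos)
      have dE := (du.pow 2).add (dp.pow 2)
      refine ((db.pow 2).div dE hx0).congr_deriv (div_eq_zero_iff.2 (Or.inl ?_))
      simp only [hE] at hφ
      simp only [Pi.add_apply, Pi.mul_apply, Pi.pow_apply]
      push_cast
      linear_combination 2 * (u μ x * Real.sin (θ x) + x * w μ x * Real.cos (θ x)) *
        (u μ x * Real.cos (θ x) - x * w μ x * Real.sin (θ x)) * hφ
    · simp [hb, hθ, angle_zero]
    · exact fun x hx => div_nonneg (sq_nonneg _) (hEpos x hx).le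
    · intro x _; simp
  have hsq : ∀ x, A x ^ 2 + b x ^ 2 = E x := by
    intro x
    simp only [hA, hb, hE]
    linear_combination (u μ x ^ 2 + (x * w μ x) ^ 2) * Real.sin_sq_add_cos_sq (θ x)
  have hApos : ∀ x ∈ Icc 0 R, 0 < A x := by
    by_contra! hcon
    obtain ⟨x, hx, hAx⟩ := hcon
    have hAc : ContinuousOn A (Icc 0 x) := by
      apply Continuous.continuousOn
      simp only [hA]; fun_prop
    have hA0 : A 0 = 1 := by simp [hA, hθ, angle_zero, h.init]
    obtain ⟨c, hc, hc0⟩ := intermediate_value_Icc' hx.1 hAc ⟨hAx, by rw [hA0]; exact zero_le_one⟩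
    have hcR : c ∈ Icc 0 R := ⟨hc.1, hc.2.trans hx.2⟩
    have h1 := hsq c
    rw [hc0, hb0 c hcR] at h1
    have := hEpos c hcR
    norm_num at h1
    linarith
  refine ⟨A r, hApos r hr, ?_, ?_⟩
  · have := hb0 r hr
    simp only [hb] at this
    simp only [hA]
    linear_combination (-u μ r) * Real.sin_sq_add_cos_sq (θ r) + Real.sin (θ r) * this
  · have := hb0 r hr
    simp only [hb] at this
    simp only [hA]
    linear_combination (-(r * w μ r)) * Real.sin_sq_add_cos_sq (θ r) + Real.cos (θ r) * this

end IsRadialFlow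

/-! ### Dependence of the Prüfer angle on the eigenvalue parameter -/

theorem hasDerivAt_sub_arctan {κ : ℝ} (hκ : 1 ≤ κ) (t : ℝ) :
    HasDerivAt (fun t => t - Real.arctan ((κ - 1) * (Real.sin t * Real.cos t) /
      (κ * Real.cos t ^ 2 + Real.sin t ^ 2)))
      (κ / (κ ^ 2 * Real.cos t ^ 2 + Real.sin t ^ 2)) t := by
  have hsc := Real.sin_sq_add_cos_sq t
  have hd : 0 < κ * Real.cos t ^ 2 + Real.sin t ^ 2 := by nlinarith [sq_nonneg (Real.cos t)]
  have hq : 0 < κ ^ 2 * Real.cos t ^ 2 + Real.sin t ^ 2 := by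
    have : 1 ≤ κ ^ 2 := by nlinarith
    nlinarith [sq_nonneg (Real.cos t)]
  have hs := Real.hasDerivAt_sin t
  have hc := Real.hasDerivAt_cos t
  refine ((hasDerivAt_id t).sub (((hs.mul hc).const_mul (κ - 1)).div
    (((hc.pow 2).const_mul κ).add (hs.pow 2)) hd.ne').arctan).congr_deriv ?_
  simp only [Pi.add_apply, Pi.mul_apply, Pi.pow_apply, Pi.div_apply]
  set s := Real.sin t
  set c := Real.cos t
  have e : 1 + ((κ - 1) * (s * c) / (κ * c ^ 2 + s ^ 2)) ^ 2 =
      (κ ^ 2 * c ^ 2 + s ^ 2) / (κ * c ^ 2 + s ^ 2) ^ 2 := by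
    field_simp
    linear_combination (κ ^ 2 * c ^ 2 + s ^ 2) * hsc
  rw [e]
  push_cast
  field_simp
  linear_combination ((κ - 1) * (s ^ 2 - κ * c ^ 2) + κ) * hsc

namespace IsRadialElliptic

/-- The right-hand side of the equation satisfied by the Prüfer angle. -/
noncomputable def angleField (F : ℝ → ℝ → ℝ → ℝ → ℝ → ℝ) (μ r θ : ℝ) : ℝ :=
  Real.sin θ ^ 2 -
    Real.cos θ * radHess F μ (-Real.sin θ / r) (-Real.sin θ) (Real.cos θ) r

theorem angleField_anti (hF : IsRadialElliptic lam Lam Γ gam del F) {μ₁ μ₂ : ℝ} (h : μ₁ ≤ μ₂)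
    (r θ : ℝ) : angleField F μ₁ r θ ≤ angleField F μ₂ r θ := by
  have := hF.mul_radHess_anti h (-Real.sin θ / r) (-Real.sin θ) (Real.cos θ) r
  unfold angleField
  linarith

theorem abs_angleField_sub_le (hF : IsRadialElliptic lam Lam Γ gam del F) {ε r : ℝ} (hε : 0 < ε)
    (hr : ε ≤ r) (μ θ₁ θ₂ : ℝ) : |angleField F μ r θ₂ - angleField F μ r θ₁| ≤
      (2 + 2 * ((Γ / ε + gam + (del + |μ|)) / lam)) * |θ₂ - θ₁| := by
  have hlam := hF.lam_pos
  have hΓ := hF.lip_nonneg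
  have hg := hF.gam_nonneg
  have hδ := hF.del_nonneg
  have hr0 : 0 < r := hε.trans_le hr
  set K := (Γ / ε + gam + (del + |μ|)) / lam with hK
  have hK0 : 0 ≤ K := by positivity
  have hKl : lam * K = Γ / ε + gam + (del + |μ|) := mul_div_cancel₀ _ hlam.ne'
  unfold angleField
  have hs := Real.abs_sin_sub_sin_le θ₂ θ₁
  have hc := Real.abs_cos_sub_cos_le θ₂ θ₁
  have hs1 := Real.abs_sin_le_one θ₁
  have hs2 := Real.abs_sin_le_one θ₂
  have hc1 := Real.abs_cos_le_one θ₁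
  have hc2 := Real.abs_cos_le_one θ₂
  have hdiv : ∀ x, Γ * |x / r| ≤ Γ / ε * |x| := by
    intro x
    rw [abs_div, abs_of_pos hr0, div_mul_eq_mul_div, mul_div_assoc]
    gcongr
  have hG2 : |radHess F μ (-Real.sin θ₂ / r) (-Real.sin θ₂) (Real.cos θ₂) r| ≤ K := by
    refine le_of_mul_le_mul_left ((hF.mul_abs_radHess_le _ _ _ _ _).trans ?_) hlam
    rw [hKl]
    have h1 := hdiv (-Real.sin θ₂)
    rw [abs_neg] at h1 ⊢
    have h2 : Γ / ε * |Real.sin θ₂| ≤ Γ / ε * 1 := by gcongr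
    have h3 : gam * |Real.sin θ₂| ≤ gam * 1 := by gcongr
    have h4 : (del + |μ|) * |Real.cos θ₂| ≤ (del + |μ|) * 1 := by gcongr
    linarith
  have hG : |radHess F μ (-Real.sin θ₂ / r) (-Real.sin θ₂) (Real.cos θ₂) r -
      radHess F μ (-Real.sin θ₁ / r) (-Real.sin θ₁) (Real.cos θ₁) r| ≤ K * |θ₂ - θ₁| := by
    refine le_of_mul_le_mul_left ((hF.radHess_lip _ _ _ _ _ _ _ _).trans ?_) hlam
    rw [← mul_assoc, hKl, ← sub_div]
    have h1 := hdiv (-Real.sin θ₂ - -Real.sin θ₁)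
    have e : |(-Real.sin θ₂ - -Real.sin θ₁)| = |Real.sin θ₂ - Real.sin θ₁| := by
      rw [← abs_neg]; congr 1; ring
    rw [e] at h1 ⊢
    have h2 : Γ / ε * |Real.sin θ₂ - Real.sin θ₁| ≤ Γ / ε * |θ₂ - θ₁| := by gcongr
    have h3 : gam * |Real.sin θ₂ - Real.sin θ₁| ≤ gam * |θ₂ - θ₁| := by gcongr
    have h4 : (del + |μ|) * |Real.cos θ₂ - Real.cos θ₁| ≤ (del + |μ|) * |θ₂ - θ₁| := by gcongr
    linarith
  generalize radHess F μ (-Real.sin θ₂ / r) (-Real.sin θ₂) (Real.cos θ₂) r = G₂ at *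
  generalize radHess F μ (-Real.sin θ₁ / r) (-Real.sin θ₁) (Real.cos θ₁) r = G₁ at *
  have e : Real.sin θ₂ ^ 2 - Real.cos θ₂ * G₂ - (Real.sin θ₁ ^ 2 - Real.cos θ₁ * G₁) =
      (Real.sin θ₂ + Real.sin θ₁) * (Real.sin θ₂ - Real.sin θ₁) +
        (-((Real.cos θ₂ - Real.cos θ₁) * G₂) + -(Real.cos θ₁ * (G₂ - G₁))) := by ring
  rw [e]
  refine (abs_add_le _ _).trans ((add_le_add_right (abs_add_le _ _) _).trans ?_)
  rw [abs_neg, abs_neg, abs_mul, abs_mul, abs_mul]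
  have h1 : |Real.sin θ₂ + Real.sin θ₁| * |Real.sin θ₂ - Real.sin θ₁| ≤ 2 * |θ₂ - θ₁| := by
    gcongr
    exact (abs_add_le _ _).trans (by linarith)
  have h2 : |Real.cos θ₂ - Real.cos θ₁| * |G₂| ≤ |θ₂ - θ₁| * K := by gcongr
  have h3 : |Real.cos θ₁| * |G₂ - G₁| ≤ 1 * (K * |θ₂ - θ₁|) := by gcongr
  linarith

theorem half_le_angleField (hF : IsRadialElliptic lam Lam Γ gam del F) {ε r κ : ℝ} (hε : 0 < ε)
    (hr : ε ≤ r) (θ : ℝ) :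
    (κ ^ 2 * Real.cos θ ^ 2 + Real.sin θ ^ 2) / 2 ≤
      angleField F (del + Lam * ((κ ^ 2 + ((Γ / ε + gam) / lam) ^ 2) / 2)) r θ := by
  have hlam := hF.lam_pos
  have hLam : 0 < Lam := hlam.trans_le hF.lam_le
  have hΓ := hF.lip_nonneg
  have hg := hF.gam_nonneg
  have hr0 : 0 < r := hε.trans_le hr
  set C := (Γ / ε + gam) / lam with hC
  have hCl : lam * C = Γ / ε + gam := mul_div_cancel₀ _ hlam.ne'
  set K := (κ ^ 2 + C ^ 2) / 2 with hK
  have hK0 : 0 ≤ K := by positivity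
  unfold angleField
  set s := Real.sin θ
  set c := Real.cos θ
  have h1 := hF.mul_radHess_le (μ := del + Lam * K)
    (by nlinarith [mul_nonneg hLam.le hK0]) c r
  rw [add_sub_cancel_left, mul_div_cancel_left₀ _ hLam.ne'] at h1
  have h2 : |radHess F (del + Lam * K) (-s / r) (-s) c r - radHess F (del + Lam * K) 0 0 c r| ≤
      C * |s| := by
    refine le_of_mul_le_mul_left ((hF.radHess_lip _ _ _ _ _ _ _ _).trans ?_) hlam
    rw [← mul_assoc, hCl]
    simp only [sub_zero, sub_self, abs_zero, mul_zero, add_zero, abs_neg, abs_div,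
      abs_of_pos hr0, add_mul]
    have : Γ * (|s| / r) ≤ Γ / ε * |s| := by
      rw [div_mul_eq_mul_div, mul_div_assoc]; gcongr
    linarith
  generalize radHess F (del + Lam * K) (-s / r) (-s) c r = G at *
  generalize radHess F (del + Lam * K) 0 0 c r = G₀ at *
  have h3 : c * (G - G₀) ≤ |c| * (C * |s|) := by
    refine (le_abs_self _).trans ?_
    rw [abs_mul]
    gcongr
  have h4 : 2 * (|c| * (C * |s|)) ≤ C ^ 2 * c ^ 2 + s ^ 2 := by
    rw [← sq_abs c, ← sq_abs s]
    nlinarith [sq_nonneg (C * |c| - |s|)]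
  nlinarith

end IsRadialElliptic

namespace IsRadialFlow

open IsRadialElliptic (angleField)

theorem angleSpeed_eq_angleField (h : IsRadialFlow F R w u)
    (hF : IsRadialElliptic lam Lam Γ gam del F) (μ : ℝ) {r : ℝ} (hr : r ∈ Ioc 0 R) :
    angleSpeed F R w u μ r = angleField F μ r (angle F R w u μ r) := by
  have hr' : r ∈ Icc 0 R := Ioc_subset_Icc_self hr
  obtain ⟨a, ha, hu, hp⟩ := h.exists_polar hF μ hr'
  set θ := angle F R w u μ r
  have hr0 := hr.1.ne'
  have hw : w μ r = a * (-Real.sin θ / r) := by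
    field_simp
    linear_combination hp
  rw [angleSpeed_of_mem hr', hp, hu, hw, neg_mul, ← mul_neg, hF.radHess_smul ha.le]
  have e : (a * Real.cos θ) ^ 2 + (a * -Real.sin θ) ^ 2 = a ^ 2 := by
    linear_combination a ^ 2 * Real.sin_sq_add_cos_sq θ
  rw [e, angleField]
  field_simp

theorem angleSpeed_pos_of_cos_eq_zero (h : IsRadialFlow F R w u)
    (hF : IsRadialElliptic lam Lam Γ gam del F) (μ : ℝ) {r : ℝ} (hr : r ∈ Icc 0 R)
    (hcos : Real.cos (angle F R w u μ r) = 0) : 0 < angleSpeed F R w u μ r := by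
  obtain ⟨a, -, hu, -⟩ := h.exists_polar hF μ hr
  have hE := h.energy_pos hF μ r hr
  rw [hcos, mul_zero] at hu
  rw [angleSpeed_of_mem hr]
  rw [hu] at hE ⊢
  refine div_pos ?_ hE
  simpa using hE

theorem lt_angle_of_le (h : IsRadialFlow F R w u) (hF : IsRadialElliptic lam Lam Γ gam del F)
    (μ : ℝ) {c r₀ : ℝ} (hc : Real.cos c = 0) (h0 : 0 ≤ r₀) (hle : c ≤ angle F R w u μ r₀) :
    ∀ r ∈ Ioc r₀ R, c < angle F R w u μ r := by
  intro r hr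
  have hR : 0 ≤ R := h0.trans (hr.1.le.trans hr.2)
  have := pos_of_upward_crossing (f := fun r => angle F R w u μ r - c) (a := r₀) (b := R)
    (fun x _ => (h.hasDerivAt_angle hF hR μ x).sub_const c) (sub_nonneg.2 hle)
    (fun x hx hx0 => h.angleSpeed_pos_of_cos_eq_zero hF μ ⟨h0.trans hx.1, hx.2⟩
      (by rw [sub_eq_zero.1 hx0, hc])) r hr
  exact sub_pos.1 this

theorem neg_pi_div_two_lt_angle (h : IsRadialFlow F R w u)
    (hF : IsRadialElliptic lam Lam Γ gam del F) (μ : ℝ) :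
    ∀ r ∈ Icc 0 R, -(Real.pi / 2) < angle F R w u μ r := by
  intro r hr
  rcases hr.1.eq_or_lt with rfl | h0
  · rw [angle_zero]; linarith [Real.pi_pos]
  · exact h.lt_angle_of_le hF μ (by rw [Real.cos_neg, Real.cos_pi_div_two]) le_rfl
      (by rw [angle_zero]; linarith [Real.pi_pos]) r ⟨h0, hr.2⟩

theorem w_zero_strictAnti (h : IsRadialFlow F R w u)
    (hF : IsRadialElliptic lam Lam Γ gam del F) : StrictAnti fun μ => w μ 0 := by
  intro μ₁ μ₂ hμ
  show w μ₂ 0 < w μ₁ 0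
  by_contra! hle
  have key : ∀ μ, F (w μ 0) (w μ 0) 0 1 0 = -μ := by
    intro μ
    have := hF.radHess_spec μ (w μ 0) 0 1 0
    rwa [← h.w_zero, mul_one] at this
  have h1 := (hF.strictMono (w μ₁ 0) 0 1 0).monotone hle
  have h2 := hF.mono (w μ₂ 0) _ _ 0 1 0 hle
  simp only [key] at h1 h2
  linarith

theorem angleSpeed_zero (h : IsRadialFlow F R w u) (hR : 0 ≤ R) (μ : ℝ) :
    angleSpeed F R w u μ 0 = -w μ 0 := by
  rw [angleSpeed_of_mem ⟨le_rfl, hR⟩, h.init, zero_mul, ← h.w_zero]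
  simp

theorem angle_strictMono (h : IsRadialFlow F R w u)
    (hF : IsRadialElliptic lam Lam Γ gam del F) (hR : 0 < R) :
    StrictMono fun μ => angle F R w u μ R := by
  intro μ₁ μ₂ hμ
  set D : ℝ → ℝ := fun r => angle F R w u μ₂ r - angle F R w u μ₁ r with hD
  have hd : ∀ r, HasDerivAt D (angleSpeed F R w u μ₂ r - angleSpeed F R w u μ₁ r) r := fun r =>
    (h.hasDerivAt_angle hF hR.le μ₂ r).sub (h.hasDerivAt_angle hF hR.le μ₁ r)
  have hpos : 0 < angleSpeed F R w u μ₂ 0 - angleSpeed F R w u μ₁ 0 := by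
    rw [h.angleSpeed_zero hR.le, h.angleSpeed_zero hR.le]
    have : w μ₂ 0 < w μ₁ 0 := h.w_zero_strictAnti hF hμ
    linarith
  obtain ⟨ε, hεD, hε0, hεR⟩ : ∃ ε, 0 < D ε ∧ 0 < ε ∧ ε < R := by
    have hslope := (hasDerivAt_iff_tendsto_slope_left_right.1 (hd 0)).2
    have h1 : ∀ᶠ y in nhdsWithin 0 (Ioi 0), 0 < slope D 0 y :=
      hslope.eventually (lt_mem_nhds hpos)
    have h2 : ∀ᶠ y in nhdsWithin (0 : ℝ) (Ioi 0), y ∈ Ioo 0 R := Ioo_mem_nhdsGT hR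
    obtain ⟨y, hy1, hy2⟩ := (h1.and h2).exists
    have hD0 : D 0 = 0 := by simp [hD, angle_zero]
    rw [slope_def_field, hD0, sub_zero, sub_zero] at hy1
    exact ⟨y, (div_pos_iff_of_pos_right hy2.1).1 hy1, hy2.1, hy2.2⟩
  have hfin := pos_of_neg_mul_le_deriv
    (L := 2 + 2 * ((Γ / ε + gam + (del + |μ₁|)) / lam)) (D := D) (a := ε) (b := R)
    (fun x _ => (hd x).continuousAt.continuousWithinAt) (fun x _ => hd x) hεD ?_ R
    (right_mem_Icc.2 hεR.le)
  · exact sub_pos.1 hfin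
  · intro x hx hDx
    have hx' : x ∈ Ioc 0 R := ⟨hε0.trans hx.1, hx.2.le⟩
    rw [h.angleSpeed_eq_angleField hF μ₁ hx', h.angleSpeed_eq_angleField hF μ₂ hx']
    have h1 := hF.angleField_anti hμ.le x (angle F R w u μ₂ x)
    have h2 := (abs_le.1 (hF.abs_angleField_sub_le hε0 hx.1.le μ₁ (angle F R w u μ₁ x)
      (angle F R w u μ₂ x))).1
    rw [abs_of_pos hDx] at h2
    rw [neg_mul]
    linarith

theorem exists_angle_le (h : IsRadialFlow F R w u)
    (hF : IsRadialElliptic lam Lam Γ gam del F) (hR : 0 ≤ R) :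
    ∃ μ, angle F R w u μ R ≤ Real.pi / 4 := by
  have hLam : 0 < Lam := hF.lam_pos.trans_le hF.lam_le
  refine ⟨-(gam + del + 2 * Lam), ?_⟩
  set μ := -(gam + del + 2 * Lam) with hμ
  refine image_le_of_deriv_right_lt_deriv_boundary (f := angle F R w u μ)
    (f' := angleSpeed F R w u μ) (a := 0) (b := R) (B := fun _ => Real.pi / 4)
    (B' := fun _ => 0)
    (fun x _ => (h.hasDerivAt_angle hF hR μ x).continuousAt.continuousWithinAt)
    (fun x _ => (h.hasDerivAt_angle hF hR μ x).hasDerivWithinAt)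
    (by rw [angle_zero]; positivity) (fun x => hasDerivAt_const x _) ?_ (right_mem_Icc.2 hR)
  intro x hx hθ
  have hx0 : 0 < x := by
    refine hx.1.lt_of_ne' fun h0 => ?_
    rw [h0, angle_zero] at hθ
    linarith [Real.pi_pos]
  rw [h.angleSpeed_eq_angleField hF μ ⟨hx0, hx.2.le⟩, hθ, angleField, Real.sin_pi_div_four,
    Real.cos_pi_div_four]
  have hs : 0 < √2 / 2 := by positivity
  set s := √2 / 2
  have h1 := hF.le_radHess (M := gam + del + 2 * Lam) (s := s) (l := -s / x) (r := x)
    (by linarith) hs.le (div_nonpos_of_nonpos_of_nonneg (by linarith) hx0.le)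
  have e : (gam + del + 2 * Lam - gam - del) / Lam = 2 := by field_simp; ring
  rw [e] at h1
  nlinarith

theorem exists_le_angle (h : IsRadialFlow F R w u)
    (hF : IsRadialElliptic lam Lam Γ gam del F) (hR : 0 < R) (A : ℝ) :
    ∃ μ, A ≤ angle F R w u μ R := by
  set κ := max 1 (4 * (A + 3 * (Real.pi / 2)) / R) with hκ
  have hκ1 : 1 ≤ κ := le_max_left _ _
  have hκA : A + 3 * (Real.pi / 2) ≤ κ / 2 * (R - R / 2) := by
    have : 4 * (A + 3 * (Real.pi / 2)) ≤ κ * R := (div_le_iff₀ hR).1 (le_max_right _ _)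
    linarith
  set μ := del + Lam * ((κ ^ 2 + ((Γ / (R / 2) + gam) / lam) ^ 2) / 2) with hμ
  refine ⟨μ, ?_⟩
  set θ := angle F R w u μ with hθ
  set ψ : ℝ → ℝ := fun t => t - Real.arctan ((κ - 1) * (Real.sin t * Real.cos t) /
      (κ * Real.cos t ^ 2 + Real.sin t ^ 2)) with hψ
  have hd : ∀ x, HasDerivAt (fun x => ψ (θ x)) (κ / (κ ^ 2 * Real.cos (θ x) ^ 2 +
      Real.sin (θ x) ^ 2) * angleSpeed F R w u μ x) x := fun x =>
    (hasDerivAt_sub_arctan hκ1 (θ x)).comp x (h.hasDerivAt_angle hF hR.le μ x)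
  have hmvt := (convex_Icc (R / 2) R).mul_sub_le_image_sub_of_le_deriv
    (f := fun x => ψ (θ x)) (C := κ / 2) (fun x _ => (hd x).continuousAt.continuousWithinAt)
    (fun x _ => (hd x).differentiableAt.differentiableWithinAt) ?_ (R / 2)
    (left_mem_Icc.2 (by linarith)) R (right_mem_Icc.2 (by linarith)) (by linarith)
  · have h1 := Real.neg_pi_div_two_lt_arctan ((κ - 1) * (Real.sin (θ R) * Real.cos (θ R)) /
      (κ * Real.cos (θ R) ^ 2 + Real.sin (θ R) ^ 2))
    have h2 := Real.arctan_lt_pi_div_two ((κ - 1) * (Real.sin (θ (R / 2)) *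
      Real.cos (θ (R / 2))) / (κ * Real.cos (θ (R / 2)) ^ 2 + Real.sin (θ (R / 2)) ^ 2))
    have h3 := h.neg_pi_div_two_lt_angle hF μ (R / 2) ⟨by linarith, by linarith⟩
    simp only [hψ] at hmvt
    linarith
  · rw [interior_Icc]
    intro x hx
    have hx0 : 0 < x := by linarith [hx.1]
    rw [(hd x).deriv, h.angleSpeed_eq_angleField hF μ ⟨hx0, hx.2.le⟩]
    have h1 := hF.half_le_angleField (κ := κ) (half_pos hR) hx.1.le (θ x)
    have hq : 0 < κ ^ 2 * Real.cos (θ x) ^ 2 + Real.sin (θ x) ^ 2 := by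
      have : 1 ≤ κ ^ 2 := by nlinarith
      nlinarith [sq_nonneg (Real.cos (θ x)), Real.sin_sq_add_cos_sq (θ x)]
    rw [div_mul_eq_mul_div, le_div_iff₀ hq]
    have h2 := mul_le_mul_of_nonneg_left h1 (zero_le_one.trans hκ1)
    exact le_trans (le_of_eq (by ring)) h2

/-- Every value above `π / 4` is attained by the angle at the boundary. -/
theorem exists_angle_eq (h : IsRadialFlow F R w u)
    (hF : IsRadialElliptic lam Lam Γ gam del F) (hR : 0 < R) {A : ℝ} (hA : Real.pi / 4 ≤ A) :
    ∃ μ, angle F R w u μ R = A := by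
  obtain ⟨μ₁, h₁⟩ := h.exists_angle_le hF hR.le
  obtain ⟨μ₂, h₂⟩ := h.exists_le_angle hF hR A
  exact mem_range_of_exists_le_of_exists_ge (h.continuous_angle hF hR.le R) ⟨μ₁, h₁.trans hA⟩
    ⟨μ₂, h₂⟩

end IsRadialFlow

/-! ### Nodal structure and uniqueness -/

namespace IsRadialFlow

theorem u_eq_zero_iff (h : IsRadialFlow F R w u) (hF : IsRadialElliptic lam Lam Γ gam del F)
    (μ : ℝ) {r : ℝ} (hr : r ∈ Icc 0 R) : u μ r = 0 ↔ Real.cos (angle F R w u μ r) = 0 := by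
  obtain ⟨a, ha, hu, -⟩ := h.exists_polar hF μ hr
  rw [hu, mul_eq_zero, or_iff_right ha.ne']

theorem exists_angle_eq_of_u_eq_zero (h : IsRadialFlow F R w u)
    (hF : IsRadialElliptic lam Lam Γ gam del F) {μ r : ℝ} (hr : r ∈ Icc 0 R) (hu : u μ r = 0) :
    ∃ k : ℕ, angle F R w u μ r = Real.pi / 2 + k * Real.pi := by
  obtain ⟨k, hk⟩ := Real.cos_eq_zero_iff.1 ((h.u_eq_zero_iff hF μ hr).1 hu)
  have hlow := h.neg_pi_div_two_lt_angle hF μ r hr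
  have hk0 : 0 ≤ k := by
    by_contra! hneg
    have : (k : ℝ) ≤ -1 := by exact_mod_cast Int.le_sub_one_of_lt hneg
    nlinarith [Real.pi_pos]
  lift k to ℕ using hk0
  refine ⟨k, hk.trans ?_⟩
  push_cast
  ring

theorem cos_pi_div_two_add_nat_mul_pi (k : ℕ) : Real.cos (Real.pi / 2 + k * Real.pi) = 0 := by
  rw [Real.cos_add_nat_mul_pi, Real.cos_pi_div_two, mul_zero]

theorem radNodalStructure (h : IsRadialFlow F R w u)
    (hF : IsRadialElliptic lam Lam Γ gam del F) (hR : 0 < R) {n : ℕ} {μ : ℝ}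
    (hμ : angle F R w u μ R = Real.pi / 2 + n * Real.pi) : RadNodalStructure R n 1 (u μ) := by
  have hπ := Real.pi_pos
  set θ := angle F R w u μ with hθ
  set α : ℕ → ℝ := fun k => Real.pi / 2 + k * Real.pi with hα
  have hαmono : StrictMono α := fun i j hij => by
    have : (i : ℝ) < j := by exact_mod_cast hij
    simp only [hα]
    gcongr
  have hαcos : ∀ k, Real.cos (α k) = 0 := cos_pi_div_two_add_nat_mul_pi
  have hθc : ContinuousOn θ (Icc 0 R) := fun r _ =>
    (h.hasDerivAt_angle hF hR.le μ r).continuousAt.continuousWithinAt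
  have hθ0 : θ 0 = 0 := angle_zero μ
  have hex : ∀ k ≤ n, ∃ x ∈ Ioc 0 R, θ x = α k := by
    intro k hk
    have hα0 : 0 < α k := by simp only [hα]; positivity
    have hmem : α k ∈ Icc (θ 0) (θ R) :=
      ⟨by rw [hθ0]; exact hα0.le, by rw [hμ]; exact hαmono.monotone hk⟩
    obtain ⟨x, hx, hxk⟩ := intermediate_value_Icc hR.le hθc hmem
    refine ⟨x, ⟨hx.1.lt_of_ne fun h0 => ?_, hx.2⟩, hxk⟩
    rw [← h0, hθ0] at hxk
    exact hα0.ne hxk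
  choose! ζ hζmem hζ using hex
  have hgt : ∀ k ≤ n, ∀ r, ζ k < r → r ≤ R → α k < θ r := fun k hk r h1 h2 =>
    h.lt_angle_of_le hF μ (hαcos k) (hζmem k hk).1.le (hζ k hk).ge r ⟨h1, h2⟩
  have hlt : ∀ k ≤ n, ∀ r, 0 ≤ r → r < ζ k → θ r < α k := by
    intro k hk r h1 h2
    by_contra! hcon
    exact (h.lt_angle_of_le hF μ (hαcos k) h1 hcon (ζ k) ⟨h2, (hζmem k hk).2⟩).ne
      (hζ k hk).symm
  have huniq : ∀ k ≤ n, ∀ r ∈ Icc 0 R, θ r = α k → r = ζ k := by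
    intro k hk r hr hrk
    rcases lt_trichotomy r (ζ k) with h1 | h1 | h1
    · exact absurd hrk (hlt k hk r hr.1 h1).ne
    · exact h1
    · exact absurd hrk (hgt k hk r h1 hr.2).ne'
  set z : ℕ → ℝ := fun i => Nat.casesOn i 0 ζ with hz
  have hz0 : z 0 = 0 := rfl
  have hzs : ∀ i, z (i + 1) = ζ i := fun i => rfl
  have hzlast : z (n + 1) = R := (huniq n le_rfl R ⟨hR.le, le_rfl⟩ hμ).symm
  refine ⟨z, hz0, hzlast, ?_, ?_, ?_⟩
  · rintro (_ | i) hi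
    · exact (hζmem 0 hi).1
    · rw [hzs, hzs]
      by_contra! hcon
      have hi' : i ≤ n := (Nat.le_succ i).trans hi
      rcases hcon.eq_or_lt with h1 | h1
      · have h2 := hζ (i + 1) hi
        rw [h1, hζ i hi'] at h2
        exact (hαmono (Nat.lt_succ_self i)).ne h2
      · have h2 := hlt i hi' _ (hζmem (i + 1) hi).1.le h1
        rw [hζ (i + 1) hi] at h2
        exact absurd h2 (hαmono (Nat.lt_succ_self i)).not_gt
  · intro r hr
    have hr' : r ∈ Icc 0 R := Ioo_subset_Icc_self hr
    constructor
    · intro hu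
      obtain ⟨k, hk⟩ := h.exists_angle_eq_of_u_eq_zero hF hr' hu
      have hkn : k < n := by
        rw [← hαmono.lt_iff_lt, ← show θ r = α k from hk]
        exact hlt n le_rfl r hr.1.le (by rw [← hzs, hzlast]; exact hr.2)
      exact ⟨k + 1, Nat.le_add_left _ _, hkn, huniq k hkn.le r hr' hk⟩
    · rintro ⟨i, hi1, hi2, hri⟩
      obtain ⟨k, rfl⟩ := Nat.exists_eq_add_of_le' hi1
      rw [h.u_eq_zero_iff hF μ hr', hri, hzs]
      change Real.cos (θ (ζ k)) = 0
      rw [hζ k (by omega), hαcos]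
  · intro i hi r hr
    have hrR : r < R := by
      rcases hi.eq_or_lt with rfl | h1
      · rw [← hzlast]; exact hr.2
      · exact hr.2.trans_le (hζmem i hi).2
    have hr0 : 0 ≤ r := by
      rcases i with _ | i
      · exact hr.1.le
      · exact (hζmem i (by omega)).1.le.trans hr.1.le
    have hupper : θ r < α i := hlt i hi r hr0 hr.2
    have hlower : i * Real.pi - Real.pi / 2 < θ r := by
      rcases i with _ | i
      · have := h.neg_pi_div_two_lt_angle hF μ r ⟨hr0, hrR.le⟩
        simpa using this
      · have := hgt i (by omega) r hr.1 hrR.le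
        simp only [hα] at this
        push_cast
        linarith
    obtain ⟨a, ha, hu, -⟩ := h.exists_polar hF μ ⟨hr0, hrR.le⟩
    have hcos : 0 < Real.cos (θ r - i * Real.pi) :=
      Real.cos_pos_of_mem_Ioo ⟨by linarith, by simp only [hα] at hupper; linarith⟩
    rw [Real.cos_sub_nat_mul_pi] at hcos
    rw [hu, one_mul]
    change 0 < (-1) ^ i * (a * Real.cos (θ r))
    rw [mul_left_comm]
    exact mul_pos ha hcos

theorem radEigenSol (h : IsRadialFlow F R w u) (hF : IsRadialElliptic lam Lam Γ gam del F)
    {μ : ℝ} (hμ : u μ R = 0) :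
    RadEigenSol F R μ (u μ) (fun r => r * w μ r)
      (fun r => radHess F μ (w μ r) (r * w μ r) (u μ r) r) := by
  have hw := h.continuous_w μ
  have hu := h.continuous_u μ
  refine ⟨⟨fun r _ => (h.deriv_u μ r).hasDerivWithinAt, by fun_prop, h.deriv_p μ, ?_⟩,
    fun r hr => ?_, zero_mul _, hμ⟩
  · exact (hF.continuous_radHess.comp (continuous_const.prodMk (hw.prodMk
      ((continuous_id.mul hw).prodMk (hu.prodMk continuous_id))))).continuousOn
  · have := hr.1.ne'
    rw [mul_div_cancel_left₀ _ this, hF.radHess_spec]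

theorem eq_mul_of_radEigenSol (h : IsRadialFlow F R w u)
    (hF : IsRadialElliptic lam Lam Γ gam del F) {μ : ℝ} {v v' v'' : ℝ → ℝ}
    (hv : RadEigenSol F R μ v v' v'') (h0 : 0 ≤ v 0) :
    ∀ r ∈ Icc 0 R, v r = v 0 * u μ r := by
  obtain ⟨⟨hv1, hv2, hv3, -⟩, hode, hv0, -⟩ := hv
  have hlam := hF.lam_pos
  have hw := h.continuous_w μ
  have hu := h.continuous_u μ
  set c := v 0 with hc
  have hvc : ContinuousOn v (Icc 0 R) := fun r hr => (hv1 r hr).continuousWithinAt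
  set β := (del + |μ|) / lam with hβ
  set η := gam / lam with hη
  have hβ0 : 0 ≤ β := by have := hF.del_nonneg; positivity
  have hη0 : 0 ≤ η := by have := hF.gam_nonneg; positivity
  have hE := eq_zero_of_deriv_le_mul
    (E := fun r => (v r - c * u μ r) ^ 2 + (v' r - c * (r * w μ r)) ^ 2)
    (E' := fun r => 2 * (v r - c * u μ r) * (v' r - c * (r * w μ r)) +
      2 * (v' r - c * (r * w μ r)) *
        (v'' r - c * radHess F μ (w μ r) (r * w μ r) (u μ r) r))
    (a := 0) (b := R) (C := 1 + 2 * η + β) ?_ ?_ ?_ ?_ ?_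
  · intro r hr
    have := hE r hr
    have h1 : (v r - c * u μ r) ^ 2 = 0 := by
      nlinarith [sq_nonneg (v r - c * u μ r), sq_nonneg (v' r - c * (r * w μ r))]
    exact sub_eq_zero.1 (pow_eq_zero_iff two_ne_zero |>.1 h1)
  · exact ((hvc.sub (by fun_prop)).pow 2).add ((hv2.sub (by fun_prop)).pow 2)
  · intro r hr
    have d1 := (hv1 r (Ioo_subset_Icc_self hr)).hasDerivAt (Icc_mem_nhds hr.1 hr.2)
    have d2 := (d1.sub ((h.deriv_u μ r).const_mul c)).pow 2
    have d3 := ((hv3 r hr).sub ((h.deriv_p μ r hr).const_mul c)).pow 2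
    refine (d2.add d3).congr_deriv ?_
    simp
  · simp [h.init, hv0, ← hc]
  · exact fun r _ => by positivity
  · intro r hr
    have hr0 := hr.1
    have hv'' : v'' r = radHess F μ (v' r / r) (v' r) (v r) r := hF.eq_radHess (hode r hr)
    rw [hv'', ← hF.radHess_smul h0]
    have hl : v' r / r - c * w μ r = (v' r - c * (r * w μ r)) / r := by
      field_simp
    have h1 : (v' r - c * (r * w μ r)) * (radHess F μ (v' r / r) (v' r) (v r) r -
        radHess F μ (c * w μ r) (v' r) (v r) r) ≤ 0 := by
      rcases le_total 0 (v' r - c * (r * w μ r)) with hy | hy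
      · refine mul_nonpos_of_nonneg_of_nonpos hy (sub_nonpos.2 (hF.radHess_anti ?_ _ _ _ _))
        have := div_nonneg hy hr0.le
        linarith
      · refine mul_nonpos_of_nonpos_of_nonneg hy (sub_nonneg.2 (hF.radHess_anti ?_ _ _ _ _))
        have := div_nonpos_of_nonpos_of_nonneg hy hr0.le
        linarith
    have h2 : |radHess F μ (c * w μ r) (v' r) (v r) r -
        radHess F μ (c * w μ r) (c * (r * w μ r)) (c * u μ r) r| ≤
        η * |v' r - c * (r * w μ r)| + β * |v r - c * u μ r| := by
      refine le_of_mul_le_mul_left ((hF.radHess_lip _ _ _ _ _ _ _ _).trans_eq ?_) hlam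
      rw [sub_self, abs_zero, mul_zero, zero_add, hη, hβ]
      field_simp
    generalize radHess F μ (v' r / r) (v' r) (v r) r = m₁ at *
    generalize radHess F μ (c * w μ r) (v' r) (v r) r = m₂ at *
    generalize radHess F μ (c * w μ r) (c * (r * w μ r)) (c * u μ r) r = m₃ at *
    generalize v' r - c * (r * w μ r) = y at *
    generalize v r - c * u μ r = x at *
    have h3 : y * (m₂ - m₃) ≤ |y| * (η * |y| + β * |x|) := by
      refine (le_abs_self _).trans ?_
      rw [abs_mul]
      gcongr
    have h4 : 2 * (|x| * |y|) ≤ x ^ 2 + y ^ 2 := by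
      rw [← sq_abs x, ← sq_abs y]; nlinarith [sq_nonneg (|x| - |y|)]
    have h5 : x * y ≤ |x| * |y| := by rw [← abs_mul]; exact le_abs_self _
    have h6 : |y| * |y| = y ^ 2 := by rw [abs_mul_abs_self]; ring
    have h7 : β * (2 * (|x| * |y|)) ≤ β * (x ^ 2 + y ^ 2) := by gcongr
    have h8 : 0 ≤ η * x ^ 2 := by positivity
    nlinarith

end IsRadialFlow

/-! ### The two half spectra -/

/-- The eigenpairs whose eigenfunctions are positive at the origin. -/
theorem IsRadialElliptic.exists_halfSpectrum (hF : IsRadialElliptic lam Lam Γ gam del F)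
    (hR : 0 < R) :
    ∃ (ev : ℕ → ℝ) (u u' u'' : ℕ → ℝ → ℝ), StrictMono ev ∧
      (∀ n, RadEigenSol F R (ev n) (u n) (u' n) (u'' n) ∧
        (∃ r ∈ Icc (0 : ℝ) R, u n r ≠ 0) ∧ RadNodalStructure R n 1 (u n)) ∧
      ∀ μ : ℝ, ∀ v v' v'' : ℝ → ℝ, RadEigenSol F R μ v v' v'' → 0 ≤ v 0 →
        (∃ r ∈ Icc (0 : ℝ) R, v r ≠ 0) →
        ∃ n, μ = ev n ∧ ∃ c : ℝ, ∀ r ∈ Icc (0 : ℝ) R, v r = c * u n r := by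
  obtain ⟨w, u, h⟩ := hF.exists_flow hR.le
  have hRmem : R ∈ Icc 0 R := ⟨hR.le, le_rfl⟩
  have hπ := Real.pi_pos
  have hmono := h.angle_strictMono hF hR
  choose ev hev using fun n : ℕ => h.exists_angle_eq hF hR
    (A := Real.pi / 2 + n * Real.pi) (by have : 0 ≤ n * Real.pi := by positivity
                                         linarith)
  refine ⟨ev, fun n => u (ev n), fun n r => r * w (ev n) r,
    fun n r => radHess F (ev n) (w (ev n) r) (r * w (ev n) r) (u (ev n) r) r, ?_, ?_, ?_⟩
  · intro i j hij
    refine hmono.lt_iff_lt.1 ?_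
    have : (i : ℝ) < j := by exact_mod_cast hij
    simp only [hev]
    gcongr
  · intro n
    refine ⟨h.radEigenSol hF ?_, ⟨0, ⟨le_rfl, hR.le⟩, by simp [h.init]⟩,
      h.radNodalStructure hF hR (hev n)⟩
    rw [h.u_eq_zero_iff hF _ hRmem, hev, IsRadialFlow.cos_pi_div_two_add_nat_mul_pi]
  · rintro μ v v' v'' hv h0 ⟨r, hr, hvr⟩
    have hvu := h.eq_mul_of_radEigenSol hF hv h0
    have hv0 : v 0 ≠ 0 := fun h1 => hvr (by rw [hvu r hr, h1, zero_mul])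
    have hu : u μ R = 0 := by
      have h1 := hvu R hRmem
      rw [hv.2.2.2] at h1
      exact (mul_eq_zero.1 h1.symm).resolve_left hv0
    obtain ⟨k, hk⟩ := h.exists_angle_eq_of_u_eq_zero hF hRmem hu
    obtain rfl : μ = ev k := hmono.injective (hk.trans (hev k).symm)
    exact ⟨k, rfl, v 0, hvu⟩

/-- The operator conjugated by `u ↦ -u`. -/
def radReflect (F : ℝ → ℝ → ℝ → ℝ → ℝ → ℝ) (m l p u r : ℝ) : ℝ := -F (-m) (-l) (-p) (-u) r

theorem IsRadialElliptic.reflect (hF : IsRadialElliptic lam Lam Γ gam del F) :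
    IsRadialElliptic lam Lam Γ gam del (radReflect F) where
  lam_pos := hF.lam_pos
  lam_le := hF.lam_le
  lip_nonneg := hF.lip_nonneg
  gam_nonneg := hF.gam_nonneg
  del_nonneg := hF.del_nonneg
  cont := (hF.cont.comp (continuous_fst.neg.prodMk (continuous_snd.fst.neg.prodMk
    (continuous_snd.snd.fst.neg.prodMk (continuous_snd.snd.snd.fst.neg.prodMk
      continuous_snd.snd.snd.snd))))).neg
  homog s hs m l p u r := by
    simp only [radReflect, ← mul_neg, hF.homog s hs]
  lower m m' l p u r h := by
    have := hF.lower (-m') (-m) (-l) (-p) (-u) r (neg_le_neg h)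
    simp only [radReflect]
    linarith
  upper m m' l p u r h := by
    have := hF.upper (-m') (-m) (-l) (-p) (-u) r (neg_le_neg h)
    simp only [radReflect]
    linarith
  mono m l l' p u r h := neg_le_neg (hF.mono _ _ _ _ _ _ (neg_le_neg h))
  lip m l p u l' p' u' r := by
    have h1 := hF.lip (-m) (-l') (-p') (-u') (-l) (-p) (-u) r
    simp only [neg_sub_neg] at h1
    simpa only [radReflect, neg_sub_neg] using h1

theorem RadEigenSol.reflect {μ : ℝ} {v v' v'' : ℝ → ℝ} (hv : RadEigenSol F R μ v v' v'') :
    RadEigenSol (radReflect F) R μ (fun r => -v r) (fun r => -v' r) (fun r => -v'' r) := by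
  obtain ⟨⟨h1, h2, h3, h4⟩, h5, h6, h7⟩ := hv
  refine ⟨⟨fun r hr => (h1 r hr).neg, h2.neg, fun r hr => (h3 r hr).neg, h4.neg⟩,
    fun r hr => ?_, by simp [h6], by simp [h7]⟩
  simp only [radReflect, neg_div, neg_neg, h5 r hr]
  ring

theorem radReflect_radReflect : radReflect (radReflect F) = F := by
  funext m l p u r
  simp [radReflect]

theorem RadNodalStructure.neg {n : ℕ} {u : ℝ → ℝ} (h : RadNodalStructure R n 1 u) :
    RadNodalStructure R n (-1) (fun r => -u r) := by
  obtain ⟨z, h1, h2, h3, h4, h5⟩ := h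
  refine ⟨z, h1, h2, h3, fun r hr => by rw [neg_eq_zero]; exact h4 r hr, fun i hi r hr => ?_⟩
  have := h5 i hi r hr
  linarith

/-! ### Operators given on the closed ball -/

theorem isRadialElliptic_clamp {N : ℕ} (hN : 1 ≤ N) (hR : 0 ≤ R) (hlam : 0 < lam)
    (hLam : lam ≤ Lam) (hgam : 0 ≤ gam) (hdel : 0 ≤ del)
    (hFcont : ContinuousOn
      (fun z : ℝ × ℝ × ℝ × ℝ × ℝ => F z.1 z.2.1 z.2.2.1 z.2.2.2.1 z.2.2.2.2)
      {z : ℝ × ℝ × ℝ × ℝ × ℝ | z.2.2.2.2 ∈ Icc 0 R})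
    (hF1 : ∀ s : ℝ, 0 ≤ s → ∀ m l p u : ℝ, ∀ r ∈ Icc (0 : ℝ) R,
      F (s * m) (s * l) (s * p) (s * u) r = s * F m l p u r)
    (hF2 : ∀ m l p u m' l' p' u' : ℝ, ∀ r ∈ Icc (0 : ℝ) R,
      Pminus N lam Lam (m - m') (l - l') - gam * |p - p'| - del * |u - u'|
          ≤ F m l p u r - F m' l' p' u' r ∧
        F m l p u r - F m' l' p' u' r
          ≤ Pplus N lam Lam (m - m') (l - l') + gam * |p - p'| + del * |u - u'|) :
    IsRadialElliptic lam Lam (((N : ℝ) - 1) * Lam) gam del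
      (fun m l p u r => F m l p u (clampRadius R r)) := by
  have hN' : (0 : ℝ) ≤ N - 1 := sub_nonneg.2 (by exact_mod_cast hN)
  have hLam0 : 0 ≤ Lam := hlam.le.trans hLam
  have hmem := fun r => clampRadius_mem hR r
  refine ⟨hlam, hLam, mul_nonneg hN' hLam0, hgam, hdel, ?_, ?_, ?_, ?_, ?_, ?_⟩
  · exact hFcont.comp_continuous (f := fun z : ℝ × ℝ × ℝ × ℝ × ℝ =>
      (z.1, z.2.1, z.2.2.1, z.2.2.2.1, clampRadius R z.2.2.2.2))
      (continuous_fst.prodMk (continuous_snd.fst.prodMk (continuous_snd.snd.fst.prodMk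
        (continuous_snd.snd.snd.fst.prodMk
          ((continuous_clampRadius R).comp continuous_snd.snd.snd.snd)))))
      fun z => hmem _
  · exact fun s hs m l p u r => hF1 s hs m l p u _ (hmem r)
  · intro m m' l p u r h
    have := (hF2 m l p u m' l p u _ (hmem r)).1
    have h1 : max (m' - m) 0 = 0 := max_eq_right (sub_nonpos.2 h)
    simpa [Pminus, max_eq_left (sub_nonneg.2 h), h1] using this
  · intro m m' l p u r h
    have := (hF2 m l p u m' l p u _ (hmem r)).2
    have h1 : max (m' - m) 0 = 0 := max_eq_right (sub_nonpos.2 h)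
    simpa [Pplus, max_eq_left (sub_nonneg.2 h), h1] using this
  · intro m l l' p u r h
    have := (hF2 m l p u m l' p u _ (hmem r)).1
    have h1 : max (-(l - l')) 0 = 0 := max_eq_right (by linarith)
    have h2 : max (l - l') 0 = l - l' := max_eq_left (sub_nonneg.2 h)
    simp only [Pminus, h1, h2, sub_self, abs_zero, mul_zero, neg_zero, max_self, zero_add,
      add_zero, sub_zero] at this
    have h3 := mul_nonneg hlam.le (mul_nonneg hN' (sub_nonneg.2 h))
    exact sub_nonneg.1 (h3.trans this)
  · intro m l p u l' p' u' r
    obtain ⟨h1, h2⟩ := hF2 m l p u m l' p' u' _ (hmem r)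
    simp only [Pminus, Pplus, sub_self, neg_zero, max_self, zero_add] at h1 h2
    have hup : max (l - l') 0 ≤ |l - l'| := max_le (le_abs_self _) (abs_nonneg _)
    have hdown : max (-(l - l')) 0 ≤ |l - l'| := max_le (neg_le_abs _) (abs_nonneg _)
    have e1 := mul_le_mul_of_nonneg_left (mul_le_mul_of_nonneg_left hup hN') hLam0
    have e2 := mul_le_mul_of_nonneg_left (mul_le_mul_of_nonneg_left hdown hN') hLam0
    have e3 := mul_nonneg hlam.le (mul_nonneg hN' (le_max_right (l - l') 0))
    have e4 := mul_nonneg hlam.le (mul_nonneg hN' (le_max_right (-(l - l')) 0))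
    rw [abs_le]
    constructor <;> linarith

theorem radEigenSol_clamp {μ : ℝ} {v v' v'' : ℝ → ℝ} :
    RadEigenSol (fun m l p u r => F m l p u (clampRadius R r)) R μ v v' v'' ↔
      RadEigenSol F R μ v v' v'' := by
  unfold RadEigenSol
  refine and_congr_right' (and_congr_left' (forall₂_congr fun r hr => ?_))
  simp only [clampRadius_of_mem (Ioo_subset_Icc_self hr)]

end RadialSpectrum

/-- the complete radial spectrum in the ball: two increasing sequences of
radial eigenvalues whose eigenfunctions have exactly `n` interior sign-changing zeros,
and every radial eigenpair belongs (up to scalar multiple) to these sequences. -/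
theorem stmt_19
    (N : ℕ) (hN : 1 ≤ N) (R lam Lam gam del : ℝ) (hR : 0 < R)
    (hlam : 0 < lam) (hLam : lam ≤ Lam) (hgam : 0 < gam) (hdel : 0 < del)
    (FF : ℝ → ℝ → ℝ → ℝ → ℝ → ℝ)
    (hFcont : ContinuousOn
      (fun z : ℝ × ℝ × ℝ × ℝ × ℝ => FF z.1 z.2.1 z.2.2.1 z.2.2.2.1 z.2.2.2.2)
      {z : ℝ × ℝ × ℝ × ℝ × ℝ | z.2.2.2.2 ∈ Icc 0 R})
    (hF1 : ∀ s : ℝ, 0 ≤ s → ∀ m l p u : ℝ, ∀ r ∈ Icc (0 : ℝ) R,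
      FF (s * m) (s * l) (s * p) (s * u) r = s * FF m l p u r)
    (hF2 : ∀ m l p u m' l' p' u' : ℝ, ∀ r ∈ Icc (0 : ℝ) R,
      Pminus N lam Lam (m - m') (l - l') - gam * |p - p'| - del * |u - u'|
          ≤ FF m l p u r - FF m' l' p' u' r ∧
        FF m l p u r - FF m' l' p' u' r
          ≤ Pplus N lam Lam (m - m') (l - l') + gam * |p - p'| + del * |u - u'|)
    (hF3 : ∀ m l p u m' l' p' u' : ℝ, ∀ r ∈ Icc (0 : ℝ) R,
      -FF (m' - m) (l' - l) (p' - p) (u' - u) r ≤ FF m l p u r - FF m' l' p' u' r ∧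
        FF m l p u r - FF m' l' p' u' r ≤ FF (m - m') (l - l') (p - p') (u - u') r)
    :
    ∃ lamP lamM : ℕ → ℝ, ∃ uP uP' uP'' uM uM' uM'' : ℕ → ℝ → ℝ,
      StrictMono lamP ∧ StrictMono lamM ∧
      (∀ n : ℕ,
        RadEigenSol FF R (lamP n) (uP n) (uP' n) (uP'' n) ∧
        (∃ r ∈ Icc (0 : ℝ) R, uP n r ≠ 0) ∧
        RadNodalStructure R n 1 (uP n) ∧
        RadEigenSol FF R (lamM n) (uM n) (uM' n) (uM'' n) ∧
        (∃ r ∈ Icc (0 : ℝ) R, uM n r ≠ 0) ∧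
        RadNodalStructure R n (-1) (uM n)) ∧
      (∀ μ : ℝ, ∀ v v' v'' : ℝ → ℝ,
        RadEigenSol FF R μ v v' v'' → (∃ r ∈ Icc (0 : ℝ) R, v r ≠ 0) →
        ∃ n : ℕ,
          (μ = lamP n ∧ ∃ c : ℝ, ∀ r ∈ Icc (0 : ℝ) R, v r = c * uP n r) ∨
          (μ = lamM n ∧ ∃ c : ℝ, ∀ r ∈ Icc (0 : ℝ) R, v r = c * uM n r)) := by
  set F : ℝ → ℝ → ℝ → ℝ → ℝ → ℝ := fun m l p u r => FF m l p u (clampRadius R r) with hFdef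
  have hF : IsRadialElliptic lam Lam (((N : ℝ) - 1) * Lam) gam del F :=
    isRadialElliptic_clamp hN hR.le hlam hLam hgam.le hdel.le hFcont hF1 hF2
  obtain ⟨evP, uP, uP', uP'', hPmono, hP, hPcompl⟩ := hF.exists_halfSpectrum hR
  obtain ⟨evM, uM, uM', uM'', hMmono, hM, hMcompl⟩ := hF.reflect.exists_halfSpectrum hR
  refine ⟨evP, evM, uP, uP', uP'', fun n r => -uM n r, fun n r => -uM' n r,
    fun n r => -uM'' n r, hPmono, hMmono, fun n => ?_, ?_⟩
  · obtain ⟨hP1, hP2, hP3⟩ := hP n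
    obtain ⟨hM1, ⟨r, hr, hne⟩, hM3⟩ := hM n
    refine ⟨radEigenSol_clamp.1 hP1, hP2, hP3, radEigenSol_clamp.1 ?_,
      ⟨r, hr, neg_ne_zero.2 hne⟩, hM3.neg⟩
    have := hM1.reflect
    rwa [radReflect_radReflect] at this
  · rintro μ v v' v'' hv ⟨r, hr, hne⟩
    have hv' := radEigenSol_clamp.2 hv
    rcases le_total 0 (v 0) with h0 | h0
    · obtain ⟨n, hn, c, hc⟩ := hPcompl μ v v' v'' hv' h0 ⟨r, hr, hne⟩
      exact ⟨n, Or.inl ⟨hn, c, hc⟩⟩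
    · obtain ⟨n, hn, c, hc⟩ := hMcompl μ _ _ _ hv'.reflect (neg_nonneg.2 h0)
        ⟨r, hr, neg_ne_zero.2 hne⟩
      refine ⟨n, Or.inr ⟨hn, c, fun s hs => ?_⟩⟩
      have := hc s hs
      linarith
end
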